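/- arXiv:1602.03039 — 2 statements merged into one kernel-verified Lean document; each statement's English description precedes it below -/
import Mathlib

section
/- Let Q be a Dynkin quiver, e, d dimension vectors with d−e ≥ 0, and suppose Ext¹_Q(M̃_e, M̃_{d−e}) = 0. Then the quiver Grassmannian Gr_e(M̃_d) of the rigid representation M̃_d is smooth and irreducible of dimension ⟨e, d−e⟩. -/
/-!
STATEMENT 10: Let Q be a Dynkin quiver, e, d dimension vectors with d−e ≥ 0, and
suppose `Ext¹_Q(M̃_e, M̃_{d−e}) = 0`.  Then the quiver Grassmannian `Gr_e(M̃_d)` of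
the rigid representation `M̃_d` is smooth and irreducible of dimension `⟨e, d−e⟩`.

Smoothness means that the (scheme-theoretic) tangent space at every point has
dimension `⟨e, d−e⟩`; irreducibility and dimension refer to the Zariski topology of
the quiver Grassmannian (a geometric quotient).  Equalities involving the Euler form
`⟨e,d−e⟩ = Σᵢ eᵢ(d−e)ᵢ − Σ_α e_{s α}(d−e)_{t α}` are stated additively to avoid
signed subtraction.
-/

noncomputable section
open Matrix

variable {V A : Type}

/-- A complex representation of the quiver `(V, A, s, t)` of dimension vector `d`. -/
abbrev QRep (s t : A → V) (d : V → ℕ) : Type :=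
  ∀ a : A, Matrix (Fin (d (t a))) (Fin (d (s a))) ℂ

/-- The quiver Grassmannian `Gr_e(M)`: families of subspaces `N i ⊆ ℂ^{d i}` of
dimension `e i` with `M_a (N (s a)) ⊆ N (t a)` for every arrow. -/
def SubRep (s t : A → V) {d : V → ℕ} (M : QRep s t d) (e : V → ℕ) : Type :=
  {N : ∀ i : V, Submodule ℂ (Fin (d i) → ℂ) //
    (∀ i, Module.finrank ℂ (N i) = e i) ∧
    ∀ a : A, (N (s a)).map (M a).mulVecLin ≤ N (t a)}

/-- The Zariski topology on the affine space `σ → ℂ`, induced from the Zariski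
topology on the prime spectrum of the polynomial ring via `x ↦ ker (eval x)`. -/
def zariski (σ : Type) : TopologicalSpace (σ → ℂ) :=
  TopologicalSpace.induced
    (fun x => (⟨RingHom.ker (MvPolynomial.eval x), RingHom.ker_isPrime _⟩ :
      PrimeSpectrum (MvPolynomial σ ℂ)))
    inferInstance

/-- Coordinates for a tuple of `(d i) × (e i)` matrices. -/
abbrev Coord (d e : V → ℕ) : Type := (Σ i : V, Fin (d i) × Fin (e i)) → ℂ

/-- The `i`-th matrix encoded by a coordinate vector. -/
def matOf {d e : V → ℕ} (F : Coord (V := V) d e) (i : V) :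
    Matrix (Fin (d i)) (Fin (e i)) ℂ :=
  fun p q => F ⟨i, (p, q)⟩

/-- The affine "Stiefel-type" variety of tuples of injective linear maps
`ℂ^{e i} → ℂ^{d i}` whose images form a subrepresentation of `M`. -/
def StQ (s t : A → V) {d : V → ℕ} (M : QRep s t d) (e : V → ℕ) : Type :=
  {F : Coord (V := V) d e //
    (∀ i, Function.Injective (matOf F i).mulVecLin) ∧
    ∀ a : A, (LinearMap.range (matOf F (s a)).mulVecLin).map (M a).mulVecLin ≤
      LinearMap.range (matOf F (t a)).mulVecLin}

/-- The canonical surjection from the Stiefel-type variety onto the quiver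
Grassmannian, sending a tuple of injective maps to the tuple of their images. -/
def toSub (s t : A → V) {d : V → ℕ} (M : QRep s t d) (e : V → ℕ) :
    StQ s t M e → SubRep s t M e := fun F =>
  ⟨fun i => LinearMap.range (matOf F.1 i).mulVecLin,
   fun i => by
     rw [LinearMap.finrank_range_of_inj (F.2.1 i)]
     exact Module.finrank_fin_fun ℂ,
   F.2.2⟩

/-- The Zariski topology on the quiver Grassmannian: the quotient (geometric
quotient) topology from the locally closed subset `StQ` of affine space. -/
instance (s t : A → V) {d : V → ℕ} (M : QRep s t d) (e : V → ℕ) :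
    TopologicalSpace (SubRep s t M e) :=
  TopologicalSpace.coinduced (toSub s t M e)
    (TopologicalSpace.induced Subtype.val (zariski _))

/-- The map `Φ^M_N`, whose cokernel is `Ext¹_Q(N,M)`. -/
def PhiFun (s t : A → V) {e d : V → ℕ} (N : QRep s t e) (M : QRep s t d) :
    (∀ i : V, Matrix (Fin (d i)) (Fin (e i)) ℂ) →
      (∀ a : A, Matrix (Fin (d (t a))) (Fin (e (s a))) ℂ) :=
  fun f a => M a * f (s a) - f (t a) * N a

/-- `Ext¹_Q(N, M) = 0`, expressed as surjectivity of `Φ^M_N` (whose cokernel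
computes `Ext¹` via the standard resolution over the path algebra). -/
def ExtVanish (s t : A → V) {e d : V → ℕ} (N : QRep s t e) (M : QRep s t d) : Prop :=
  Function.Surjective (PhiFun s t N M)

/-- A representation is rigid if `Ext¹_Q(M, M) = 0`. -/
def Rigid (s t : A → V) {d : V → ℕ} (M : QRep s t d) : Prop :=
  ExtVanish s t M M

/-- The Euler form `⟨x,y⟩ = Σ_i x i * y i − Σ_a x (s a) * y (t a)` of the quiver. -/
def eulerForm [Fintype V] [Fintype A] (s t : A → V) (x y : V → ℤ) : ℤ :=
  (∑ i : V, x i * y i) - ∑ a : A, x (s a) * y (t a)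

/-- The quiver is Dynkin (disjoint union of simply-laced Dynkin diagrams), i.e. its
Tits form is positive definite. -/
def IsDynkin [Fintype V] [Fintype A] (s t : A → V) : Prop :=
  ∀ x : V → ℤ, x ≠ 0 → 0 < eulerForm s t x x

/-- Morphisms of representations `X → Y`, given by matrices `φ i` with
`Y_a φ_{s a} = φ_{t a} X_a`. -/
def RHom (s t : A → V) {dX dY : V → ℕ} (X : QRep s t dX) (Y : QRep s t dY) : Type :=
  {φ : ∀ i : V, Matrix (Fin (dY i)) (Fin (dX i)) ℂ //
    ∀ a : A, Y a * φ (s a) = φ (t a) * X a}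

/-- The (scheme-theoretic) tangent space of the quiver Grassmannian at a point
`x = (N i)ᵢ`: families of linear maps `φ i : N i → ℂ^{d i}/N i` commuting with the
maps induced by `M`.  This space is canonically `Hom_Q(L, M/L)`, where `L` is the
subrepresentation corresponding to `x`. -/
def TangentSp (s t : A → V) {d : V → ℕ} (M : QRep s t d) {e : V → ℕ}
    (x : SubRep s t M e) :
    Submodule ℂ (∀ i : V, (x.1 i →ₗ[ℂ] ((Fin (d i) → ℂ) ⧸ x.1 i))) where
  carrier := {φ | ∀ (a : A) (v : x.1 (s a)),
    φ (t a) ⟨(M a).mulVecLin v, x.2.2 a (Submodule.mem_map_of_mem v.2)⟩ =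
      Submodule.mapQ (x.1 (s a)) (x.1 (t a)) (M a).mulVecLin
        (Submodule.map_le_iff_le_comap.mp (x.2.2 a)) (φ (s a) v)}
  add_mem' := by
    intro φ ψ hφ hψ a v
    simp only [Pi.add_apply, LinearMap.add_apply, hφ a v, hψ a v, map_add]
  zero_mem' := by
    intro a v
    simp
  smul_mem' := by
    intro c φ hφ a v
    simp only [Pi.smul_apply, LinearMap.smul_apply, hφ a v, LinearMap.map_smul]

/-! ### Dimension theory at the origin of affine space -/

section Algebra

open MvPolynomial

/-- The maximal ideal of the polynomial ring at the origin. -/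
abbrev originIdeal (σ : Type) : Ideal (MvPolynomial σ ℂ) := vanishingIdeal ℂ {(0 : σ → ℂ)}

lemma mem_originIdeal {σ : Type} {p : MvPolynomial σ ℂ} :
    p ∈ originIdeal σ ↔ eval 0 p = 0 := by
  rw [originIdeal, mem_vanishingIdeal_singleton_iff]; rfl

/-- The primes between an ideal and the ideal of the origin. -/
abbrev PrimesAtOrigin {σ : Type} (I : Ideal (MvPolynomial σ ℂ)) : Type :=
  {P : PrimeSpectrum (MvPolynomial σ ℂ) // I ≤ P.asIdeal ∧ P.asIdeal ≤ originIdeal σ}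

lemma originIdeal_le_span_X (σ : Type) :
    originIdeal σ ≤ Ideal.span (Set.range (X : σ → MvPolynomial σ ℂ)) := by
  intro p hp
  rw [← Set.image_univ, mem_ideal_span_X_image]
  intro m hm
  by_contra! h
  have hm0 : m = 0 := by ext i; simpa using h i (Set.mem_univ i)
  subst hm0
  rw [mem_originIdeal, eval_zero, constantCoeff_eq] at hp
  exact (mem_support_iff.mp hm) hp

lemma le_height_originIdeal (σ : Type) [Fintype σ] :
    (Fintype.card σ : ℕ∞) ≤ (originIdeal σ).height := by
  have h1 : ringKrullDim (MvPolynomial σ ℂ) ≤ ((originIdeal σ).height : WithBot ℕ∞) := by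
    rw [ringKrullDim_le_iff_isMaximal_height_le]
    intro m hm
    obtain ⟨x, rfl⟩ := eq_vanishingIdeal_singleton_of_isMaximal ℂ hm
    let f : MvPolynomial σ ℂ →ₐ[ℂ] MvPolynomial σ ℂ := aeval fun i => X i + C (x i)
    let g : MvPolynomial σ ℂ →ₐ[ℂ] MvPolynomial σ ℂ := aeval fun i => X i - C (x i)
    let e : MvPolynomial σ ℂ ≃ₐ[ℂ] MvPolynomial σ ℂ :=
      AlgEquiv.ofAlgHom f g (by ext i; simp [f, g]) (by ext i; simp [f, g])
    have : (originIdeal σ).comap e.toRingEquiv = vanishingIdeal ℂ {x} := by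
      ext p
      rw [Ideal.mem_comap, mem_originIdeal, mem_vanishingIdeal_singleton_iff]
      have : ∀ q : MvPolynomial σ ℂ, eval 0 (f q) = aeval x q := by
        intro q
        have : (aeval (0 : σ → ℂ)).comp f = aeval x := by ext i; simp [f]
        exact DFunLike.congr_fun this q
      exact (this p).symm ▸ Iff.rfl
    rw [← this, RingEquiv.height_comap]
  rw [MvPolynomial.ringKrullDim_of_isNoetherianRing, ringKrullDim_eq_zero_of_field, zero_add,
    Nat.card_eq_fintype_card] at h1
  exact_mod_cast h1

lemma krullDim_primesAtOrigin {σ : Type} {I : Ideal (MvPolynomial σ ℂ)} (hI : I ≤ originIdeal σ) :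
    Order.krullDim (PrimesAtOrigin I) =
      (((originIdeal σ).map (Ideal.Quotient.mk I)).height : WithBot ℕ∞) := by
  have hp := Ideal.isPrime_map_quotientMk_of_isPrime hI
  let x : PrimeSpectrum (MvPolynomial σ ℂ ⧸ I) := ⟨_, hp⟩
  have hx : (x.asIdeal).height = Order.height x := PrimeSpectrum.height_eq_orderHeight x
  let e := I.primeSpectrumQuotientOrderIsoZeroLocus
  have hex : (e x).1.asIdeal = originIdeal σ := by
    change Ideal.comap (Ideal.Quotient.mk I) (Ideal.map (Ideal.Quotient.mk I) _) = _
    rw [Ideal.comap_map_of_surjective _ Ideal.Quotient.mk_surjective, ← RingHom.ker,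
      Ideal.mk_ker, sup_eq_left.mpr hI]
  change _ = ((x.asIdeal).height : WithBot ℕ∞)
  rw [hx, ← Order.height_orderIso e, Order.height_eq_krullDim_Iic]
  refine Order.krullDim_eq_of_orderIso
    { toFun := fun P => ⟨⟨P.1, P.2.1⟩, by
        change P.1.asIdeal ≤ (e x).1.asIdeal
        rw [hex]; exact P.2.2⟩
      invFun := fun P => ⟨P.1.1, P.1.2, by
        have : P.1.1.asIdeal ≤ (e x).1.asIdeal := P.2
        rwa [hex] at this⟩
      left_inv := fun _ => rfl
      right_inv := fun _ => rfl
      map_rel_iff' := Iff.rfl }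

lemma card_le_krullDim_add {σ κ : Type} [Fintype σ] [Fintype κ] (f : κ → MvPolynomial σ ℂ)
    (hf : ∀ k, eval 0 (f k) = 0) :
    (Fintype.card σ : WithBot ℕ∞) ≤
      Order.krullDim (PrimesAtOrigin (Ideal.span (Set.range f))) + Fintype.card κ := by
  have hs : Set.range f ⊆ originIdeal σ := by
    rintro _ ⟨k, rfl⟩; exact mem_originIdeal.mpr (hf k)
  rw [krullDim_primesAtOrigin (Ideal.span_le.mpr hs)]
  have h1 := (le_height_originIdeal σ).trans (Ideal.height_le_height_add_encard_of_subset _ hs)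
  have h2 : (Set.range f).encard ≤ Fintype.card κ := by
    rw [← Set.image_univ]
    refine (Set.encard_image_le _ _).trans ?_
    simp
  have h3 := h1.trans (add_le_add le_rfl h2)
  exact_mod_cast h3

/-- The linear form as a polynomial. -/
def linPoly {σ : Type} [Fintype σ] [DecidableEq σ] :
    ((σ → ℂ) →ₗ[ℂ] ℂ) →ₗ[ℂ] MvPolynomial σ ℂ where
  toFun l := ∑ i, C (l (Pi.single i 1)) * X i
  map_add' l m := by simp [add_mul, Finset.sum_add_distrib]
  map_smul' c l := by simp [Finset.smul_sum, smul_eq_C_mul, mul_assoc]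

lemma eval_linPoly {σ : Type} [Fintype σ] [DecidableEq σ] (l : (σ → ℂ) →ₗ[ℂ] ℂ) (x : σ → ℂ) :
    eval x (linPoly l) = l x := by
  conv_rhs => rw [pi_eq_sum_univ' x, map_sum]
  simp only [linPoly, LinearMap.coe_mk, AddHom.coe_mk, map_sum, map_mul, eval_C, eval_X]
  refine Finset.sum_congr rfl fun i _ => ?_
  rw [map_smul, smul_eq_mul, mul_comm]

lemma linPoly_proj {σ : Type} [Fintype σ] [DecidableEq σ] (i : σ) :
    linPoly (LinearMap.proj i) = (X i : MvPolynomial σ ℂ) := by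
  refine MvPolynomial.funext fun x => ?_
  rw [eval_linPoly]; simp

lemma prime_eq_originIdeal {σ : Type} [Fintype σ] {P : Ideal (MvPolynomial σ ℂ)} (hP : P.IsPrime)
    (hle : P ≤ originIdeal σ) (h : originIdeal σ ≤ P ⊔ originIdeal σ ^ 2) :
    originIdeal σ ≤ P := by
  rw [pow_two, ← smul_eq_mul] at h
  obtain ⟨r, hr, hr2⟩ := Submodule.exists_sub_one_mem_and_smul_le_of_fg_of_le_sup
    (IsNoetherian.noetherian (originIdeal σ)) le_rfl h
  have hrP : r ∉ P := fun hrP => by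
    have : (1 : MvPolynomial σ ℂ) ∈ originIdeal σ := by
      simpa using sub_mem (hle hrP) hr
    rw [mem_originIdeal] at this
    simp at this
  intro p hp
  have : r • p ∈ P := hr2 (Submodule.smul_mem_pointwise_smul _ _ _ hp)
  exact (hP.mem_or_mem this).resolve_left hrP

lemma krullDim_add_card_le {σ κ : Type} [Fintype σ] [DecidableEq σ] [Fintype κ]
    (f : κ → MvPolynomial σ ℂ) (D : (σ → ℂ) →ₗ[ℂ] (κ → ℂ)) (hD : Function.Surjective D)
    (hf : ∀ k, f k - linPoly (LinearMap.proj k ∘ₗ D) ∈ originIdeal σ ^ 2) :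
    Order.krullDim (PrimesAtOrigin (Ideal.span (Set.range f))) + Fintype.card κ ≤
      (Fintype.card σ : WithBot ℕ∞) := by
  classical
  have hlin : ∀ l : (σ → ℂ) →ₗ[ℂ] ℂ, linPoly l ∈ originIdeal σ := fun l => by
    rw [mem_originIdeal, eval_linPoly, map_zero]
  have hI : Ideal.span (Set.range f) ≤ originIdeal σ := by
    rw [Ideal.span_le]
    rintro _ ⟨k, rfl⟩
    rw [← sub_add_cancel (f k) (linPoly (LinearMap.proj k ∘ₗ D))]
    exact add_mem (Ideal.pow_le_self two_ne_zero (hf k)) (hlin _)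
  rw [krullDim_primesAtOrigin hI]
  set I := Ideal.span (Set.range f) with hIdef
  have hrank := D.finrank_range_add_finrank_ker
  rw [LinearMap.range_eq_top.mpr hD, finrank_top, Module.finrank_fintype_fun_eq_card,
    Module.finrank_fintype_fun_eq_card] at hrank
  set n := Module.finrank ℂ (LinearMap.ker D) with hn
  obtain ⟨p, hp⟩ := (LinearMap.ker D).subtype.exists_leftInverse_of_injective
    (LinearMap.ker D).ker_subtype
  let b := (Module.finBasis ℂ (LinearMap.ker D)).equivFun
  let D' : (σ → ℂ) →ₗ[ℂ] (Fin n → ℂ) := b.toLinearMap ∘ₗ p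
  obtain ⟨S, hS⟩ := D.exists_rightInverse_of_surjective (LinearMap.range_eq_top.mpr hD)
  have hS' : ∀ v, D (S v) = v := fun v => LinearMap.congr_fun hS v
  have hdecomp : ∀ z : σ → ℂ, z = S (D z) - (p (S (D z)) : σ → ℂ) + (b.symm (D' z) : σ → ℂ) := by
    intro z
    have hz : z - S (D z) ∈ LinearMap.ker D := by
      rw [LinearMap.mem_ker, map_sub, hS', sub_self]
    have h1 : p (z - S (D z)) = ⟨_, hz⟩ := LinearMap.congr_fun hp ⟨_, hz⟩
    have h2 : b.symm (D' z) = p z := b.symm_apply_apply _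
    have h3 : (p z : σ → ℂ) - (p (S (D z)) : σ → ℂ) = z - S (D z) := by
      rw [← Submodule.coe_sub, ← map_sub, h1]
    rw [h2]
    linear_combination -h3
  let T : (κ → ℂ) →ₗ[ℂ] (σ → ℂ) := S - (LinearMap.ker D).subtype ∘ₗ p ∘ₗ S
  let T' : (Fin n → ℂ) →ₗ[ℂ] (σ → ℂ) := (LinearMap.ker D).subtype ∘ₗ b.symm.toLinearMap
  have hproj : ∀ i : σ, (LinearMap.proj i : (σ → ℂ) →ₗ[ℂ] ℂ) =
      ∑ k, (T (Pi.single k 1) i) • (LinearMap.proj k ∘ₗ D) +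
      ∑ j, (T' (Pi.single j 1) i) • (LinearMap.proj j ∘ₗ D') := by
    intro i
    refine LinearMap.ext fun z => ?_
    have h1 := congrFun (hdecomp z) i
    have h2 : ∀ v : κ → ℂ, T v i = ∑ k, T (Pi.single k 1) i * v k := by
      intro v
      conv_lhs => rw [pi_eq_sum_univ' v, map_sum, Finset.sum_apply]
      refine Finset.sum_congr rfl fun k _ => ?_
      rw [map_smul, Pi.smul_apply, smul_eq_mul, mul_comm]
    have h3 : ∀ v : Fin n → ℂ, T' v i = ∑ k, T' (Pi.single k 1) i * v k := by
      intro v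
      conv_lhs => rw [pi_eq_sum_univ' v, map_sum, Finset.sum_apply]
      refine Finset.sum_congr rfl fun k _ => ?_
      rw [map_smul, Pi.smul_apply, smul_eq_mul, mul_comm]
    simp only [LinearMap.add_apply, LinearMap.sum_apply, LinearMap.smul_apply, smul_eq_mul,
      LinearMap.comp_apply, LinearMap.proj_apply]
    rw [← h2, ← h3]
    exact h1
  let q := Ideal.Quotient.mk I
  let t : Set (MvPolynomial σ ℂ ⧸ I) := Set.range fun j => q (linPoly (LinearMap.proj j ∘ₗ D'))
  have hprime := Ideal.isPrime_map_quotientMk_of_isPrime hI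
  have hmin : (originIdeal σ).map q ∈ (Ideal.span t).minimalPrimes := by
    refine ⟨⟨hprime, ?_⟩, ?_⟩
    · rw [Ideal.span_le]
      rintro _ ⟨j, rfl⟩
      exact Ideal.mem_map_of_mem _ (hlin _)
    · rintro Q ⟨hQ, htQ⟩ hQle
      have hcm : ((originIdeal σ).map q).comap q = originIdeal σ := by
        rw [Ideal.comap_map_of_surjective _ Ideal.Quotient.mk_surjective, ← RingHom.ker,
          Ideal.mk_ker, sup_eq_left.mpr hI]
      have hIQ : I ≤ Q.comap q := fun x hx => by
        rw [Ideal.mem_comap, Ideal.Quotient.eq_zero_iff_mem.mpr hx]; exact zero_mem _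
      rw [Ideal.map_le_iff_le_comap]
      refine prime_eq_originIdeal (hQ.comap q) (hcm ▸ Ideal.comap_mono hQle) ?_
      refine (originIdeal_le_span_X σ).trans (Ideal.span_le.mpr ?_)
      rintro _ ⟨i, rfl⟩
      rw [← linPoly_proj, hproj, map_add, map_sum, map_sum]
      refine add_mem (sum_mem fun k _ => ?_) (sum_mem fun j _ => ?_)
      · rw [map_smul, smul_eq_C_mul]
        refine Ideal.mul_mem_left _ _ ?_
        rw [← sub_sub_cancel (f k) (linPoly (LinearMap.proj k ∘ₗ D))]
        exact sub_mem (Ideal.mem_sup_left (hIQ (Ideal.subset_span ⟨k, rfl⟩)))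
          (Ideal.mem_sup_right (hf k))
      · rw [map_smul, smul_eq_C_mul]
        exact Ideal.mul_mem_left _ _ (Ideal.mem_sup_left (htQ (Ideal.subset_span ⟨j, rfl⟩)))
  have h1 := Ideal.height_le_card_of_mem_minimalPrimes_span (Set.finite_range _) hmin
  have h2 : t.ncard ≤ n := by
    change (Set.range _).ncard ≤ n
    rw [← Set.image_univ]
    refine (Set.ncard_image_le Set.finite_univ).trans ?_
    simp [Set.ncard_univ]
  have h3 : (((originIdeal σ).map q).height : ℕ∞) + Fintype.card κ ≤ Fintype.card σ := by
    rw [← hrank, Nat.cast_add, add_comm]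
    exact add_le_add le_rfl (h1.trans (by exact_mod_cast h2))
  exact_mod_cast h3

/-- If the linear parts of the `f k` and of `g` are jointly independent, then `g` does not vanish
identically near the origin on the common zero locus of the `f k`. -/
lemma exists_zero_avoiding {σ κ : Type} [Fintype σ] [DecidableEq σ] [Fintype κ]
    (f : κ → MvPolynomial σ ℂ) (g : MvPolynomial σ ℂ) (hg0 : eval 0 g = 0)
    (D : (σ → ℂ) →ₗ[ℂ] (κ → ℂ)) (l : (σ → ℂ) →ₗ[ℂ] ℂ)
    (hD : Function.Surjective (D.prod l))
    (hf : ∀ k, f k - linPoly (LinearMap.proj k ∘ₗ D) ∈ originIdeal σ ^ 2)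
    (hg : g - linPoly l ∈ originIdeal σ ^ 2)
    (h : MvPolynomial σ ℂ) (hh : eval 0 h ≠ 0) :
    ∃ x : σ → ℂ, (∀ k, eval x (f k) = 0) ∧ eval x g ≠ 0 ∧ eval x h ≠ 0 := by
  by_contra! hcon
  have hf0 : ∀ k, eval 0 (f k) = 0 := fun k => by
    rw [← mem_originIdeal, ← sub_add_cancel (f k) (linPoly (LinearMap.proj k ∘ₗ D))]
    exact add_mem (Ideal.pow_le_self two_ne_zero (hf k))
      (mem_originIdeal.mpr (by rw [eval_linPoly, map_zero]))
  let F : Option κ → MvPolynomial σ ℂ := fun k => k.elim g f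
  let DF : (σ → ℂ) →ₗ[ℂ] (Option κ → ℂ) :=
    LinearMap.pi fun k => k.elim l fun k => LinearMap.proj k ∘ₗ D
  have hDF : Function.Surjective DF := by
    intro c
    obtain ⟨z, hz⟩ := hD (fun k => c (some k), c none)
    refine ⟨z, funext fun k => ?_⟩
    cases k with
    | none => exact congrArg Prod.snd hz
    | some k => exact congrFun (congrArg Prod.fst hz) k
  have hB := krullDim_add_card_le F DF hDF (fun k => by
    cases k with
    | none => exact hg
    | some k => exact hf k)
  have hA := card_le_krullDim_add f hf0
  have hle : Order.krullDim (PrimesAtOrigin (Ideal.span (Set.range f))) ≤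
      Order.krullDim (PrimesAtOrigin (Ideal.span (Set.range F))) := by
    refine Order.krullDim_le_of_strictMono (fun P => ⟨P.1, ?_, P.2.2⟩) (fun P Q h => h)
    rw [Ideal.span_le]
    rintro _ ⟨k, rfl⟩
    cases k with
    | some k => exact P.2.1 (Ideal.subset_span ⟨k, rfl⟩)
    | none =>
      have hmem : g * h ∈ P.1.asIdeal := by
        have := P.1.2
        rw [← IsPrime.vanishingIdeal_zeroLocus (K := ℂ) P.1.asIdeal]
        intro x hx
        have hx' : ∀ k, eval x (f k) = 0 := fun k => hx _ (P.2.1 (Ideal.subset_span ⟨k, rfl⟩))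
        change eval x (g * h) = 0
        rw [map_mul]
        by_cases hgx : eval x g = 0
        · rw [hgx, zero_mul]
        · rw [hcon x hx' hgx, mul_zero]
      exact (P.1.2.mem_or_mem hmem).resolve_right fun hP => hh (mem_originIdeal.mp (P.2.2 hP))
  have hI : Ideal.span (Set.range F) ≤ originIdeal σ := by
    rw [Ideal.span_le]
    rintro _ ⟨k, rfl⟩
    cases k with
    | none => exact mem_originIdeal.mpr hg0
    | some k => exact mem_originIdeal.mpr (hf0 k)
  have h1 := hA.trans (add_le_add hle le_rfl)
  rw [krullDim_primesAtOrigin hI] at h1 hB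
  rw [Fintype.card_option] at hB
  have h1' : (Fintype.card σ : ℕ∞) ≤
    ((originIdeal σ).map (Ideal.Quotient.mk (Ideal.span (Set.range F)))).height +
      Fintype.card κ := by exact_mod_cast h1
  have hB' : ((originIdeal σ).map (Ideal.Quotient.mk (Ideal.span (Set.range F)))).height +
      ((Fintype.card κ + 1 : ℕ) : ℕ∞) ≤ Fintype.card σ := by exact_mod_cast hB
  generalize ((originIdeal σ).map (Ideal.Quotient.mk (Ideal.span (Set.range F)))).height = m
    at h1' hB'
  cases m with
  | top => simp at hB'
  | coe m =>
    norm_cast at h1' hB'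
    omega

end Algebra

/-! ### Algebras of polynomial functions -/

section Functions

variable {T : Type} (S : Subalgebra ℂ (T → ℂ))

lemma eval_mem_subalgebra {σ : Type} {c : T → σ → ℂ} (hc : ∀ i, (fun x => c x i) ∈ S)
    (p : MvPolynomial σ ℂ) : (fun x => MvPolynomial.eval (c x) p) ∈ S := by
  induction p using MvPolynomial.induction_on with
  | C a =>
    simp only [MvPolynomial.eval_C]
    exact S.algebraMap_mem a
  | add p q hp hq =>
    simp only [map_add]
    exact S.add_mem hp hq
  | mul_X p i hp =>
    simp only [map_mul, MvPolynomial.eval_X]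
    exact S.mul_mem hp (hc i)

lemma const_mem_subalgebra (a : ℂ) : (fun _ => a) ∈ S := S.algebraMap_mem a

lemma sum_mem_subalgebra {ι : Type} (s : Finset ι) {f : ι → T → ℂ} (hf : ∀ i, f i ∈ S) :
    (fun x => ∑ i ∈ s, f i x) ∈ S := by
  convert S.sum_mem (t := s) fun i _ => hf i using 1
  ext; simp

lemma prod_mem_subalgebra {ι : Type} (s : Finset ι) {f : ι → T → ℂ} (hf : ∀ i, f i ∈ S) :
    (fun x => ∏ i ∈ s, f i x) ∈ S := by
  convert S.prod_mem (t := s) fun i _ => hf i using 1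
  ext; simp

lemma matrix_mul_mem_subalgebra {l m n : Type} [Fintype m] {A : T → Matrix l m ℂ}
    {B : T → Matrix m n ℂ} (hA : ∀ i j, (fun x => A x i j) ∈ S) (hB : ∀ i j, (fun x => B x i j) ∈ S)
    (i : l) (j : n) : (fun x => (A x * B x) i j) ∈ S := by
  simp only [Matrix.mul_apply]
  exact sum_mem_subalgebra S _ fun k => S.mul_mem (hA i k) (hB k j)

lemma det_mem_subalgebra {n : Type} [Fintype n] [DecidableEq n] {A : T → Matrix n n ℂ}
    (hA : ∀ i j, (fun x => A x i j) ∈ S) : (fun x => (A x).det) ∈ S := by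
  simp only [Matrix.det_apply']
  exact sum_mem_subalgebra S _ fun g =>
    S.mul_mem (const_mem_subalgebra S _) (prod_mem_subalgebra S _ fun i => hA _ _)

lemma adjugate_mem_subalgebra {n : Type} [Fintype n] [DecidableEq n] {A : T → Matrix n n ℂ}
    (hA : ∀ i j, (fun x => A x i j) ∈ S) (i j : n) : (fun x => (A x).adjugate i j) ∈ S := by
  simp only [Matrix.adjugate_apply]
  refine det_mem_subalgebra S fun k l => ?_
  by_cases hk : k = j
  · subst hk
    simpa using const_mem_subalgebra S _
  · simpa [Matrix.updateRow_ne hk] using hA k l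

/-- Polynomial functions of one complex variable. -/
def polyFun : Subalgebra ℂ (ℂ → ℂ) where
  carrier := {f | ∃ P : Polynomial ℂ, ∀ x, P.eval x = f x}
  mul_mem' := by
    rintro f g ⟨P, hP⟩ ⟨Q, hQ⟩
    exact ⟨P * Q, fun x => by simp [hP, hQ]⟩
  add_mem' := by
    rintro f g ⟨P, hP⟩ ⟨Q, hQ⟩
    exact ⟨P + Q, fun x => by simp [hP, hQ]⟩
  algebraMap_mem' a := ⟨Polynomial.C a, fun x => by simp⟩

lemma id_mem_polyFun : (fun x : ℂ => x) ∈ polyFun := ⟨Polynomial.X, fun x => by simp⟩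

lemma one_sub_mem_polyFun : (fun x : ℂ => 1 - x) ∈ polyFun :=
  ⟨1 - Polynomial.X, fun x => by simp⟩

lemma comp_one_sub_mem_polyFun {f : ℂ → ℂ} (hf : f ∈ polyFun) :
    (fun x => f (1 - x)) ∈ polyFun := by
  obtain ⟨P, hP⟩ := hf
  exact ⟨P.comp (1 - Polynomial.X), fun x => by simp [hP]⟩

lemma exists_mul_ne_zero_of_polyFun {f g : ℂ → ℂ} (hf : f ∈ polyFun) (hg : g ∈ polyFun) {x y : ℂ}
    (hx : f x ≠ 0) (hy : g y ≠ 0) : ∃ z, (f * g) z ≠ 0 := by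
  obtain ⟨P, hP⟩ := hf
  obtain ⟨Q, hQ⟩ := hg
  by_contra! h
  have h0 : P * Q = 0 := Polynomial.funext fun z => by
    have := h z
    rw [Pi.mul_apply, ← hP, ← hQ] at this
    simpa using this
  rcases mul_eq_zero.mp h0 with h0 | h0
  · exact hx (by rw [← hP, h0, Polynomial.eval_zero])
  · exact hy (by rw [← hQ, h0, Polynomial.eval_zero])

/-- Functions that are regular where the polynomial `δ` does not vanish. -/
def regFun {σ : Type} (δ : MvPolynomial σ ℂ) : Subalgebra ℂ ((σ → ℂ) → ℂ) where
  carrier := {f | ∃ (n : ℕ) (q : MvPolynomial σ ℂ), ∀ x, MvPolynomial.eval x δ ≠ 0 →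
    f x * MvPolynomial.eval x δ ^ n = MvPolynomial.eval x q}
  mul_mem' := by
    rintro f g ⟨n, p, hp⟩ ⟨m, q, hq⟩
    refine ⟨n + m, p * q, fun x hx => ?_⟩
    rw [map_mul, ← hp x hx, ← hq x hx, Pi.mul_apply]; ring
  add_mem' := by
    rintro f g ⟨n, p, hp⟩ ⟨m, q, hq⟩
    refine ⟨n + m, p * δ ^ m + q * δ ^ n, fun x hx => ?_⟩
    rw [map_add, map_mul, map_mul, map_pow, map_pow, ← hp x hx, ← hq x hx, Pi.add_apply]; ring
  algebraMap_mem' a := ⟨0, MvPolynomial.C a, fun x _ => by simp⟩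

lemma coord_mem_regFun {σ : Type} (δ : MvPolynomial σ ℂ) (i : σ) :
    (fun x : σ → ℂ => x i) ∈ regFun δ := ⟨0, MvPolynomial.X i, fun x _ => by simp⟩

/-- The vanishing of a regular function extends to a polynomial condition. -/
lemma exists_poly_of_mem_regFun {σ : Type} {δ : MvPolynomial σ ℂ} {f : (σ → ℂ) → ℂ}
    (hf : f ∈ regFun δ) : ∃ q : MvPolynomial σ ℂ, ∀ x, MvPolynomial.eval x q = 0 ↔
      (MvPolynomial.eval x δ = 0 ∨ f x = 0) := by
  obtain ⟨n, q, hq⟩ := hf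
  refine ⟨δ * q, fun x => ?_⟩
  by_cases hx : MvPolynomial.eval x δ = 0
  · simp [hx]
  · rw [map_mul, ← hq x hx]
    simp [hx]

lemma exists_poly_of_mem_regFun_one {σ : Type} {f : (σ → ℂ) → ℂ}
    (hf : f ∈ regFun (1 : MvPolynomial σ ℂ)) :
    ∃ q : MvPolynomial σ ℂ, ∀ x, MvPolynomial.eval x q = f x := by
  obtain ⟨n, q, hq⟩ := hf
  exact ⟨q, fun x => by simpa using (hq x (by simp)).symm⟩

end Functions

/-- A point in the kernel of a surjective member of a linear pencil extends to a polynomial curve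
of kernel vectors. -/
lemma exists_kernel_curve {X Y : Type} [AddCommGroup X] [Module ℂ X] [AddCommGroup Y] [Module ℂ Y]
    [Module.Finite ℂ Y] (T₀ T₁ : X →ₗ[ℂ] Y) (hT : Function.Surjective T₀) (x₀ : X)
    (hx : T₀ x₀ = 0) :
    ∃ γ : ℂ → X, γ 0 = x₀ ∧ (∀ τ, T₀ (γ τ) + τ • T₁ (γ τ) = 0) ∧
      ∀ l : X →ₗ[ℂ] ℂ, (fun τ => l (γ τ)) ∈ polyFun := by
  obtain ⟨R, hR⟩ := T₀.exists_rightInverse_of_surjective (LinearMap.range_eq_top.mpr hT)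
  have hR' : ∀ v, T₀ (R v) = v := fun v => LinearMap.congr_fun hR v
  let b := Module.finBasis ℂ Y
  let B := LinearMap.toMatrix b b (T₁ ∘ₗ R)
  let M : ℂ → Matrix _ _ ℂ := fun τ => 1 + τ • B
  have hM : ∀ i j, (fun τ => M τ i j) ∈ polyFun := fun i j =>
    polyFun.add_mem (const_mem_subalgebra _ ((1 : Matrix _ _ ℂ) i j))
      (polyFun.mul_mem id_mem_polyFun (const_mem_subalgebra _ (B i j)))
  let E := b.equivFun
  have hE : ∀ τ w, T₀ (R (E.symm w)) + τ • T₁ (R (E.symm w)) = E.symm (M τ *ᵥ w) := by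
    intro τ w
    apply E.injective
    rw [E.apply_symm_apply, map_add, map_smul, hR', E.apply_symm_apply, Matrix.add_mulVec,
      Matrix.one_mulVec, Matrix.smul_mulVec]
    congr 2
    have := LinearMap.toMatrix_mulVec_repr b b (T₁ ∘ₗ R) (E.symm w)
    have h2 : ⇑(b.repr (E.symm w)) = w := E.apply_symm_apply w
    rw [h2] at this
    exact this.symm
  refine ⟨fun τ => (M τ).det • x₀ - τ • R (E.symm ((M τ).adjugate *ᵥ E (T₁ x₀))), ?_, ?_, ?_⟩
  · simp [M]
  · intro τ
    have h1 := hE τ ((M τ).adjugate *ᵥ E (T₁ x₀))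
    rw [Matrix.mulVec_mulVec, Matrix.mul_adjugate, Matrix.smul_mulVec, Matrix.one_mulVec,
      map_smul, E.symm_apply_apply] at h1
    simp only [map_sub, map_smul, hx, smul_zero, smul_sub]
    rw [smul_comm τ (M τ).det, ← smul_comm τ, ← h1, smul_add]
    abel
  · intro l
    simp only [map_sub, map_smul, smul_eq_mul]
    refine polyFun.sub_mem (polyFun.mul_mem (det_mem_subalgebra _ hM)
      (const_mem_subalgebra _ _)) (polyFun.mul_mem id_mem_polyFun ?_)
    have : ∀ w : Fin (Module.finrank ℂ Y) → ℂ, l (R (E.symm w)) =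
        ∑ j, w j * l (R (E.symm (Pi.single j 1))) := by
      intro w
      conv_lhs => rw [pi_eq_sum_univ' w]
      simp only [map_sum, map_smul, smul_eq_mul]
    rw [funext fun τ => this ((M τ).adjugate *ᵥ E (T₁ x₀))]
    simp only [Matrix.mulVec, dotProduct]
    exact sum_mem_subalgebra _ _ fun j => polyFun.mul_mem
      (sum_mem_subalgebra _ _ fun k => polyFun.mul_mem
        (adjugate_mem_subalgebra _ hM _ _) (const_mem_subalgebra _ _))
      (const_mem_subalgebra _ _)

/-! ### Zariski closed subsets -/

lemma isClosed_zariski_iff {σ : Type} {Z : Set (σ → ℂ)} :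
    @IsClosed _ (zariski σ) Z ↔
      ∃ S : Set (MvPolynomial σ ℂ), Z = {x | ∀ p ∈ S, MvPolynomial.eval x p = 0} := by
  refine (@isClosed_induced_iff _ _ _ _ _).trans ?_
  constructor
  · rintro ⟨t, ht, rfl⟩
    obtain ⟨S, rfl⟩ := (PrimeSpectrum.isClosed_iff_zeroLocus t).mp ht
    exact ⟨S, rfl⟩
  · rintro ⟨S, rfl⟩
    exact ⟨PrimeSpectrum.zeroLocus S, PrimeSpectrum.isClosed_zeroLocus S, rfl⟩

lemma isClosed_subRep_iff {s t : A → V} {d : V → ℕ} {M : QRep s t d} {e : V → ℕ}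
    {C : Set (SubRep s t M e)} :
    IsClosed C ↔ ∃ S : Set (MvPolynomial (Σ i : V, Fin (d i) × Fin (e i)) ℂ),
      ∀ F : StQ s t M e, toSub s t M e F ∈ C ↔ ∀ p ∈ S, MvPolynomial.eval F.1 p = 0 := by
  refine isClosed_coinduced.trans ?_
  refine (@isClosed_induced_iff _ _ (zariski _) _ _).trans ?_
  simp only [isClosed_zariski_iff]
  constructor
  · rintro ⟨_, ⟨S, rfl⟩, h⟩
    exact ⟨S, fun F => (Set.ext_iff.mp h F).symm⟩
  · rintro ⟨S, h⟩
    exact ⟨_, ⟨S, rfl⟩, Set.ext fun F => (h F).symm⟩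

/-! ### Split inclusions of coordinate spaces -/

/-- A decomposition of `ℂ ^ d` as a direct sum of `ℂ ^ e` and `ℂ ^ k`, in terms of matrices. -/
structure Split (d e k : ℕ) where
  /-- The inclusion of the first summand. -/
  J : Matrix (Fin d) (Fin e) ℂ
  /-- The inclusion of the second summand. -/
  K : Matrix (Fin d) (Fin k) ℂ
  /-- The projection to the first summand. -/
  P : Matrix (Fin e) (Fin d) ℂ
  /-- The projection to the second summand. -/
  R : Matrix (Fin k) (Fin d) ℂ
  PJ : P * J = 1
  PK : P * K = 0
  RJ : R * J = 0
  RK : R * K = 1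
  sum : J * P + K * R = 1

lemma exists_split {d e : ℕ} (N : Submodule ℂ (Fin d → ℂ)) (h : Module.finrank ℂ N = e) :
    ∃ S : Split d e (d - e), LinearMap.range S.J.mulVecLin = N := by
  obtain ⟨N', hN⟩ := N.exists_isCompl
  have h' : Module.finrank ℂ N' = d - e := by
    have := Submodule.finrank_add_eq_of_isCompl hN
    rw [Module.finrank_fin_fun] at this
    omega
  let E₁ : N ≃ₗ[ℂ] (Fin e → ℂ) := (Module.finBasisOfFinrankEq ℂ N h).equivFun
  let E₂ : N' ≃ₗ[ℂ] (Fin (d - e) → ℂ) := (Module.finBasisOfFinrankEq ℂ N' h').equivFun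
  let E : ((Fin e → ℂ) × (Fin (d - e) → ℂ)) ≃ₗ[ℂ] (Fin d → ℂ) :=
    (E₁.symm.prodCongr E₂.symm).trans (Submodule.prodEquivOfIsCompl N N' hN)
  refine ⟨⟨LinearMap.toMatrix' (E.toLinearMap ∘ₗ LinearMap.inl ℂ _ _),
    LinearMap.toMatrix' (E.toLinearMap ∘ₗ LinearMap.inr ℂ _ _),
    LinearMap.toMatrix' (LinearMap.fst ℂ _ _ ∘ₗ E.symm.toLinearMap),
    LinearMap.toMatrix' (LinearMap.snd ℂ _ _ ∘ₗ E.symm.toLinearMap), ?_, ?_, ?_, ?_, ?_⟩, ?_⟩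
  · rw [← LinearMap.toMatrix'_comp, ← LinearMap.toMatrix'_id]
    congr 1
    ext; simp
  · rw [← LinearMap.toMatrix'_comp, ← map_zero LinearMap.toMatrix']
    congr 1
    ext; simp
  · rw [← LinearMap.toMatrix'_comp, ← map_zero LinearMap.toMatrix']
    congr 1
    ext; simp
  · rw [← LinearMap.toMatrix'_comp, ← LinearMap.toMatrix'_id]
    congr 1
    ext; simp
  · rw [← LinearMap.toMatrix'_comp, ← LinearMap.toMatrix'_comp, ← map_add,
      ← LinearMap.toMatrix'_id]
    congr 1
    refine LinearMap.ext fun v => ?_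
    obtain ⟨w, rfl⟩ := E.surjective v
    simp only [LinearMap.add_apply, LinearMap.comp_apply, LinearEquiv.coe_coe,
      LinearEquiv.symm_apply_apply, LinearMap.fst_apply, LinearMap.snd_apply, ← map_add]
    simp
  · rw [← Matrix.toLin'_apply', Matrix.toLin'_toMatrix']
    ext v
    constructor
    · rintro ⟨w, rfl⟩
      simp [E]
    · intro hv
      refine ⟨E₁ ⟨v, hv⟩, ?_⟩
      simp [E]

lemma range_mulVecLin_le_iff {l m n : ℕ} {A : Matrix (Fin l) (Fin m) ℂ}
    {B : Matrix (Fin l) (Fin n) ℂ} :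
    LinearMap.range A.mulVecLin ≤ LinearMap.range B.mulVecLin ↔
      ∃ C : Matrix (Fin n) (Fin m) ℂ, A = B * C := by
  constructor
  · intro h
    have h' : ∀ j, ∃ c, B *ᵥ c = A.col j := fun j =>
      h ⟨Pi.single j 1, by rw [Matrix.mulVecLin_apply, Matrix.mulVec_single_one]⟩
    choose c hc using h'
    refine ⟨Matrix.of fun p j => c j p, ?_⟩
    ext i j
    exact (congrFun (hc j) i).symm
  · rintro ⟨C, rfl⟩
    rw [Matrix.mulVecLin_mul]
    exact LinearMap.range_comp_le_range _ _

lemma exists_left_inverse_of_injective {m n : ℕ} {A : Matrix (Fin m) (Fin n) ℂ}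
    (h : Function.Injective A.mulVecLin) : ∃ L : Matrix (Fin n) (Fin m) ℂ, L * A = 1 := by
  obtain ⟨g, hg⟩ := LinearMap.exists_leftInverse_of_injective A.mulVecLin
    (LinearMap.ker_eq_bot.mpr h)
  refine ⟨LinearMap.toMatrix' g, ?_⟩
  have : A = LinearMap.toMatrix' A.mulVecLin := by
    rw [← Matrix.toLin'_apply', LinearMap.toMatrix'_toLin']
  conv_lhs => rw [this]
  rw [← LinearMap.toMatrix'_comp, hg, LinearMap.toMatrix'_id]

lemma injective_of_det_ne_zero {m n : ℕ} {A : Matrix (Fin m) (Fin n) ℂ}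
    (L : Matrix (Fin n) (Fin m) ℂ) (h : (L * A).det ≠ 0) : Function.Injective A.mulVecLin := by
  have h1 : Function.Injective (L * A).mulVec :=
    Matrix.mulVec_injective_iff_isUnit.mpr
      ((Matrix.isUnit_iff_isUnit_det _).mpr (isUnit_iff_ne_zero.mpr h))
  intro v w hvw
  apply h1
  simp only [Matrix.mulVecLin_apply] at hvw
  rw [← Matrix.mulVec_mulVec, ← Matrix.mulVec_mulVec, hvw]

lemma map_range_mulVecLin_le_iff {l m n k : ℕ} {M : Matrix (Fin l) (Fin m) ℂ}
    {A : Matrix (Fin m) (Fin n) ℂ} {B : Matrix (Fin l) (Fin k) ℂ} :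
    (LinearMap.range A.mulVecLin).map M.mulVecLin ≤ LinearMap.range B.mulVecLin ↔
      ∃ C : Matrix (Fin k) (Fin n) ℂ, M * A = B * C := by
  rw [← LinearMap.range_comp, ← Matrix.mulVecLin_mul, range_mulVecLin_le_iff]

section Curves

variable {s t : A → V} {d e : V → ℕ}

/-- The coordinate vector of a family of matrices. -/
def ofMat (G : ∀ i, Matrix (Fin (d i)) (Fin (e i)) ℂ) : Coord d e := fun x => G x.1 x.2.1 x.2.2

lemma matOf_ofMat (G : ∀ i, Matrix (Fin (d i)) (Fin (e i)) ℂ) (i : V) : matOf (ofMat G) i = G i :=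
  rfl

lemma ofMat_matOf (F : Coord d e) : ofMat (matOf F) = F := rfl

lemma toSub_surjective (s t : A → V) (M : QRep s t d) (e : V → ℕ) :
    Function.Surjective (toSub s t M e) := by
  intro x
  choose S hS using fun i => exists_split (x.1 i) (x.2.1 i)
  have h : ∀ i, matOf (ofMat fun i => (S i).J) i = (S i).J := fun i => rfl
  refine ⟨⟨ofMat fun i => (S i).J, fun i => ?_, fun a => ?_⟩, ?_⟩
  · rw [h]
    exact injective_of_det_ne_zero (S i).P (by simp [(S i).PJ])
  · rw [h, h, hS, hS]
    exact x.2.2 a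
  · refine Subtype.ext (funext fun i => ?_)
    exact hS i

/-- The representation induced on a subrepresentation. -/
lemma StQ.exists_restriction {M : QRep s t d} (F : StQ s t M e) :
    ∃ N : QRep s t e, ∀ a, M a * matOf F.1 (s a) = matOf F.1 (t a) * N a :=
  ⟨fun a => (map_range_mulVecLin_le_iff.mp (F.2.2 a)).choose,
    fun a => (map_range_mulVecLin_le_iff.mp (F.2.2 a)).choose_spec⟩

lemma Rigid.extVanish_of_injective {M : QRep s t d} (hM : Rigid s t M) {N : QRep s t e}
    {F : ∀ i, Matrix (Fin (d i)) (Fin (e i)) ℂ} (hF : ∀ i, Function.Injective (F i).mulVecLin)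
    (h : ∀ a, M a * F (s a) = F (t a) * N a) : ExtVanish s t N M := by
  choose L hL using fun i => exists_left_inverse_of_injective (hF i)
  intro c
  obtain ⟨f, hf⟩ := hM fun a => c a * L (s a)
  refine ⟨fun i => f i * F i, funext fun a => ?_⟩
  have := congrFun hf a
  simp only [PhiFun] at this ⊢
  rw [← Matrix.mul_assoc, Matrix.mul_assoc (f (t a)), ← h, ← Matrix.mul_assoc, ← Matrix.sub_mul,
    this, Matrix.mul_assoc, hL, Matrix.mul_one]

/-- If `Ext(N₀, M)` vanishes then a morphism `N₀ → M` extends to polynomial families of morphisms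
along every line through `N₀`. -/
lemma exists_hom_curve [Finite A] {N₀ : QRep s t e} {M : QRep s t d}
    (h : ExtVanish s t N₀ M) (F₀ : ∀ i, Matrix (Fin (d i)) (Fin (e i)) ℂ)
    (hF : ∀ a, M a * F₀ (s a) = F₀ (t a) * N₀ a) (N₁ : QRep s t e) :
    ∃ γ : ℂ → ∀ i, Matrix (Fin (d i)) (Fin (e i)) ℂ, γ 0 = F₀ ∧
      (∀ τ a, M a * γ τ (s a) = γ τ (t a) * (N₀ a + τ • N₁ a)) ∧
      ∀ i p q, (fun τ => γ τ i p q) ∈ polyFun := by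
  let T₀ : (∀ i, Matrix (Fin (d i)) (Fin (e i)) ℂ) →ₗ[ℂ]
      (∀ a : A, Matrix (Fin (d (t a))) (Fin (e (s a))) ℂ) :=
    { toFun := PhiFun s t N₀ M
      map_add' := fun x y => funext fun a => by
        simp only [PhiFun, Pi.add_apply, Matrix.mul_add, Matrix.add_mul]; abel
      map_smul' := fun c x => funext fun a => by
        simp [PhiFun, smul_sub] }
  let T₁ : (∀ i, Matrix (Fin (d i)) (Fin (e i)) ℂ) →ₗ[ℂ]
      (∀ a : A, Matrix (Fin (d (t a))) (Fin (e (s a))) ℂ) :=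
    { toFun := fun f a => - (f (t a) * N₁ a)
      map_add' := fun x y => funext fun a => by
        simp only [Pi.add_apply, Matrix.add_mul]; abel
      map_smul' := fun c x => funext fun a => by
        simp }
  obtain ⟨γ, h0, hγ, hl⟩ := exists_kernel_curve T₀ T₁ h F₀
    (funext fun a => sub_eq_zero.mpr (hF a))
  refine ⟨γ, h0, fun τ a => ?_, fun i p q => ?_⟩
  · have := congrFun (hγ τ) a
    simp only [T₀, T₁, LinearMap.coe_mk, AddHom.coe_mk, PhiFun, Pi.add_apply, Pi.smul_apply,
      Pi.zero_apply] at this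
    rw [Matrix.mul_add, Matrix.mul_smul, ← sub_eq_zero, ← this, smul_neg]
    abel
  · exact hl (LinearMap.proj q ∘ₗ LinearMap.proj p ∘ₗ
      (LinearMap.proj i : (∀ i, Matrix (Fin (d i)) (Fin (e i)) ℂ) →ₗ[ℂ] _))

lemma Rigid.preirreducibleSpace_subRep [Fintype V] [Finite A] {M : QRep s t d}
    (hM : Rigid s t M) (e : V → ℕ) : PreirreducibleSpace (SubRep s t M e) := by
  refine ⟨fun U₁ U₂ hU₁ hU₂ h₁ h₂ => ?_⟩
  simp only [Set.univ_inter] at h₁ h₂ ⊢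
  obtain ⟨S₁, hS₁⟩ := isClosed_subRep_iff.mp hU₁.isClosed_compl
  obtain ⟨S₂, hS₂⟩ := isClosed_subRep_iff.mp hU₂.isClosed_compl
  obtain ⟨x₁, hx₁⟩ := h₁
  obtain ⟨x₂, hx₂⟩ := h₂
  obtain ⟨F₁, rfl⟩ := toSub_surjective s t M e x₁
  obtain ⟨F₂, rfl⟩ := toSub_surjective s t M e x₂
  have hp₁ : ¬ ∀ p ∈ S₁, MvPolynomial.eval F₁.1 p = 0 := fun h => (hS₁ F₁).mpr h hx₁
  have hp₂ : ¬ ∀ p ∈ S₂, MvPolynomial.eval F₂.1 p = 0 := fun h => (hS₂ F₂).mpr h hx₂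
  push Not at hp₁ hp₂
  obtain ⟨p₁, hpS₁, hp₁⟩ := hp₁
  obtain ⟨p₂, hpS₂, hp₂⟩ := hp₂
  obtain ⟨N₁, hN₁⟩ := F₁.exists_restriction
  obtain ⟨N₂, hN₂⟩ := F₂.exists_restriction
  obtain ⟨γ₁, h10, h1, h1p⟩ := exists_hom_curve (hM.extVanish_of_injective F₁.2.1 hN₁) _ hN₁
    (fun a => N₂ a - N₁ a)
  obtain ⟨γ₂, h20, h2, h2p⟩ := exists_hom_curve (hM.extVanish_of_injective F₂.2.1 hN₂) _ hN₂
    (fun a => N₁ a - N₂ a)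
  choose L hL using fun i => exists_left_inverse_of_injective (F₁.2.1 i)
  let γ : ℂ → ∀ i, Matrix (Fin (d i)) (Fin (e i)) ℂ := fun τ i =>
    (1 - τ) • γ₁ τ i + τ • γ₂ (1 - τ) i
  have hγ0 : ofMat (γ 0) = F₁.1 := by
    rw [← ofMat_matOf F₁.1, ← h10]; congr 1; ext; simp [γ]
  have hγ1 : ofMat (γ 1) = F₂.1 := by
    rw [← ofMat_matOf F₂.1, ← h20]; congr 1; ext; simp [γ]
  have hγp : ∀ x, (fun τ => ofMat (γ τ) x) ∈ polyFun := fun x =>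
    polyFun.add_mem (polyFun.mul_mem one_sub_mem_polyFun (h1p _ _ _))
      (polyFun.mul_mem id_mem_polyFun (comp_one_sub_mem_polyFun (h2p _ _ _)))
  have hδ : (fun τ => ∏ i, (L i * γ τ i).det) ∈ polyFun :=
    prod_mem_subalgebra _ _ fun i => det_mem_subalgebra _ fun p q =>
      matrix_mul_mem_subalgebra _ (A := fun _ => L i) (fun p q => const_mem_subalgebra _ _)
        (fun p q => hγp ⟨i, p, q⟩) p q
  have hδ0 : ∏ i, (L i * γ 0 i).det ≠ 0 := by
    refine Finset.prod_ne_zero_iff.mpr fun i _ => ?_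
    rw [← matOf_ofMat (γ 0), hγ0, hL, Matrix.det_one]
    exact one_ne_zero
  have hq₁ := eval_mem_subalgebra polyFun hγp p₁
  have hq₂ := eval_mem_subalgebra polyFun hγp p₂
  obtain ⟨τ, hτ⟩ := exists_mul_ne_zero_of_polyFun (polyFun.mul_mem hq₁ hδ) hq₂ (x := 0) (y := 1)
    (mul_ne_zero (by simpa only [hγ0] using hp₁) hδ0) (by simpa only [hγ1] using hp₂)
  simp only [Pi.mul_apply, mul_ne_zero_iff] at hτ
  obtain ⟨⟨hτ1, hτδ⟩, hτ2⟩ := hτ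
  let F : StQ s t M e := ⟨ofMat (γ τ), fun i => injective_of_det_ne_zero (L i)
    (Finset.prod_ne_zero_iff.mp hτδ i (Finset.mem_univ i)), fun a =>
    map_range_mulVecLin_le_iff.mpr ⟨N₁ a + τ • (N₂ a - N₁ a), by
      change M a * ((1 - τ) • γ₁ τ (s a) + τ • γ₂ (1 - τ) (s a)) =
        ((1 - τ) • γ₁ τ (t a) + τ • γ₂ (1 - τ) (t a)) * (N₁ a + τ • (N₂ a - N₁ a))
      rw [Matrix.mul_add, Matrix.mul_smul, Matrix.mul_smul, h1, h2, Matrix.add_mul,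
        Matrix.smul_mul, Matrix.smul_mul]
      congr 3
      module⟩⟩
  refine ⟨toSub s t M e F, ?_, ?_⟩
  · by_contra hc
    exact hτ1 ((hS₁ F).mp hc p₁ hpS₁)
  · by_contra hc
    exact hτ2 ((hS₂ F).mp hc p₂ hpS₂)

end Curves

/-! ### The tangent space -/

lemma Rigid.finrank_tangentSp [Fintype V] [Fintype A] {s t : A → V} {d e : V → ℕ}
    {M : QRep s t d} (hM : Rigid s t M) (x : SubRep s t M e) :
    Module.finrank ℂ (TangentSp s t M x) + ∑ a : A, e (s a) * (d (t a) - e (t a)) =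
      ∑ i : V, e i * (d i - e i) := by
  let Ψ : (∀ i, (x.1 i →ₗ[ℂ] ((Fin (d i) → ℂ) ⧸ x.1 i))) →ₗ[ℂ]
      (∀ a, (x.1 (s a) →ₗ[ℂ] ((Fin (d (t a)) → ℂ) ⧸ x.1 (t a)))) :=
    { toFun := fun φ a => φ (t a) ∘ₗ (M a).mulVecLin.restrict
          (fun v hv => x.2.2 a (Submodule.mem_map_of_mem hv)) -
        Submodule.mapQ (x.1 (s a)) (x.1 (t a)) (M a).mulVecLin
          (Submodule.map_le_iff_le_comap.mp (x.2.2 a)) ∘ₗ φ (s a)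
      map_add' := fun φ ψ => funext fun a => by
        simp only [Pi.add_apply, LinearMap.add_comp, LinearMap.comp_add]; abel
      map_smul' := fun c φ => funext fun a => by
        simp only [Pi.smul_apply, LinearMap.smul_comp, LinearMap.comp_smul, smul_sub,
          RingHom.id_apply] }
  have hker : TangentSp s t M x = LinearMap.ker Ψ := by
    ext φ
    rw [LinearMap.mem_ker, funext_iff]
    refine forall_congr' fun a => ?_
    rw [Pi.zero_apply, LinearMap.ext_iff]
    exact forall_congr' fun v => sub_eq_zero.symm
  have hsurj : Function.Surjective Ψ := by
    intro c
    have hg : ∀ a, ∃ g : (Fin (d (s a)) → ℂ) →ₗ[ℂ] (Fin (d (t a)) → ℂ),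
        ∀ v : x.1 (s a), (x.1 (t a)).mkQ (g v) = c a v := by
      intro a
      obtain ⟨g₁, hg₁⟩ := (c a).exists_extend
      obtain ⟨r, hr⟩ := (x.1 (t a)).mkQ.exists_rightInverse_of_surjective
        (Submodule.range_mkQ _)
      refine ⟨r ∘ₗ g₁, fun v => ?_⟩
      rw [← hg₁]
      exact LinearMap.congr_fun hr _
    choose g hg using hg
    obtain ⟨f, hf⟩ := hM fun a => - LinearMap.toMatrix' (g a)
    refine ⟨fun i => (x.1 i).mkQ ∘ₗ (f i).mulVecLin ∘ₗ (x.1 i).subtype, funext fun a => ?_⟩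
    ext v
    have h1 := congrArg (fun B => (x.1 (t a)).mkQ (B *ᵥ (v : Fin (d (s a)) → ℂ))) (congrFun hf a)
    simp only [PhiFun, Matrix.sub_mulVec, Matrix.neg_mulVec, LinearMap.toMatrix'_mulVec,
      map_sub, map_neg, hg] at h1
    rw [← neg_neg (c a v), ← h1, neg_sub, ← Matrix.mulVec_mulVec, ← Matrix.mulVec_mulVec]
    rfl
  have h := LinearMap.finrank_range_add_finrank_ker (K := ℂ)
    (V := ∀ i, (x.1 i →ₗ[ℂ] ((Fin (d i) → ℂ) ⧸ x.1 i)))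
    (V₂ := ∀ a, (x.1 (s a) →ₗ[ℂ] ((Fin (d (t a)) → ℂ) ⧸ x.1 (t a)))) Ψ
  rw [LinearMap.range_eq_top.mpr hsurj, finrank_top, ← hker] at h
  simp only [Module.finrank_pi_fintype, Module.finrank_linearMap, Submodule.finrank_quotient,
    Module.finrank_self, Finset.sum_const, Finset.card_univ, Fintype.card_fin, smul_eq_mul, mul_one,
    x.2.1] at h
  omega

/-! ### Affine algebraic sets -/

section AffineSets

open MvPolynomial TopologicalSpace

/-- The common zero locus of a family of polynomials. -/
def AffZeros {σ κ : Type} (f : κ → MvPolynomial σ ℂ) : Type :=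
  {y : σ → ℂ // ∀ k, eval y (f k) = 0}

instance {σ κ : Type} (f : κ → MvPolynomial σ ℂ) : TopologicalSpace (AffZeros f) :=
  TopologicalSpace.induced Subtype.val (zariski σ)

/-- The origin as a point of the zero locus. -/
def AffZeros.origin {σ κ : Type} {f : κ → MvPolynomial σ ℂ} (hf : ∀ k, eval 0 (f k) = 0) :
    AffZeros f := ⟨0, hf⟩

lemma isClosed_affZeros_iff {σ κ : Type} {f : κ → MvPolynomial σ ℂ} {Z : Set (AffZeros f)} :
    IsClosed Z ↔ ∃ S : Set (MvPolynomial σ ℂ), ∀ y : AffZeros f,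
      y ∈ Z ↔ ∀ p ∈ S, eval y.1 p = 0 := by
  refine (@isClosed_induced_iff _ _ (zariski _) _ _).trans ?_
  simp only [isClosed_zariski_iff]
  constructor
  · rintro ⟨_, ⟨S, rfl⟩, h⟩
    exact ⟨S, fun F => (Set.ext_iff.mp h F).symm⟩
  · rintro ⟨S, h⟩
    exact ⟨_, ⟨S, rfl⟩, Set.ext fun F => (h F).symm⟩

lemma mem_vanishingIdeal_image {σ κ : Type} {f : κ → MvPolynomial σ ℂ} {Z : Set (AffZeros f)}
    {p : MvPolynomial σ ℂ} :
    p ∈ vanishingIdeal ℂ (Subtype.val '' Z) ↔ ∀ y ∈ Z, eval y.1 p = 0 :=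
  (Set.forall_mem_image (f := Subtype.val) (s := Z) (p := fun x => eval x p = 0))

lemma isPrime_vanishingIdeal_image {σ κ : Type} {f : κ → MvPolynomial σ ℂ} {Z : Set (AffZeros f)}
    (hZ : IsIrreducible Z) : (vanishingIdeal ℂ (Subtype.val '' Z)).IsPrime := by
  have hcl : ∀ p : MvPolynomial σ ℂ, IsClosed {y : AffZeros f | eval y.1 p = 0} := fun p =>
    isClosed_affZeros_iff.mpr ⟨{p}, fun y => by simp⟩
  refine ⟨fun h => ?_, fun {p q} h => ?_⟩
  · obtain ⟨y, hy⟩ := hZ.nonempty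
    have := mem_vanishingIdeal_image.mp ((Ideal.eq_top_iff_one _).mp h) y hy
    simp at this
  · simp only [mem_vanishingIdeal_image, map_mul, mul_eq_zero] at h ⊢
    exact isPreirreducible_iff_isClosed_union_isClosed.mp hZ.2 _ _ (hcl p) (hcl q) h

lemma exists_eval_ne_zero_of_notMem_prime {σ κ : Type} [Finite σ] {f : κ → MvPolynomial σ ℂ}
    {P : Ideal (MvPolynomial σ ℂ)} [P.IsPrime] (hP : Ideal.span (Set.range f) ≤ P)
    {p : MvPolynomial σ ℂ} (hp : p ∉ P) :
    ∃ y : AffZeros f, (∀ q ∈ P, eval y.1 q = 0) ∧ eval y.1 p ≠ 0 := by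
  by_contra! h
  refine hp ?_
  rw [← IsPrime.vanishingIdeal_zeroLocus (K := ℂ) P]
  exact fun y hy => h ⟨y, fun k => hy _ (hP (Ideal.subset_span ⟨k, rfl⟩))⟩ hy

lemma isIrreducible_zeros {σ κ : Type} [Finite σ] {f : κ → MvPolynomial σ ℂ}
    (hf : ∀ k, eval 0 (f k) = 0) (Q : PrimesAtOrigin (Ideal.span (Set.range f))) :
    IsIrreducible {y : AffZeros f | ∀ p ∈ Q.1.asIdeal, eval y.1 p = 0} := by
  refine ⟨⟨AffZeros.origin hf, fun p hp => mem_originIdeal.mp (Q.2.2 hp)⟩, ?_⟩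
  rw [isPreirreducible_iff_isClosed_union_isClosed]
  intro Z₁ Z₂ h₁ h₂ h
  obtain ⟨S₁, hS₁⟩ := isClosed_affZeros_iff.mp h₁
  obtain ⟨S₂, hS₂⟩ := isClosed_affZeros_iff.mp h₂
  by_contra hcon
  rw [not_or] at hcon
  obtain ⟨y₁, hy₁, hn₁⟩ := Set.not_subset.mp hcon.1
  obtain ⟨y₂, hy₂, hn₂⟩ := Set.not_subset.mp hcon.2
  rw [hS₁] at hn₁
  rw [hS₂] at hn₂
  push Not at hn₁ hn₂
  obtain ⟨p₁, hp₁, hn₁⟩ := hn₁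
  obtain ⟨p₂, hp₂, hn₂⟩ := hn₂
  have hQ₁ : p₁ ∉ Q.1.asIdeal := fun hc => hn₁ (hy₁ _ hc)
  have hQ₂ : p₂ ∉ Q.1.asIdeal := fun hc => hn₂ (hy₂ _ hc)
  have hQ : p₁ * p₂ ∉ Q.1.asIdeal := fun hc =>
    (Q.1.isPrime.mem_or_mem hc).elim hQ₁ hQ₂
  obtain ⟨y, hy, hne⟩ := exists_eval_ne_zero_of_notMem_prime Q.2.1 hQ
  rw [map_mul] at hne
  rcases h hy with hz | hz
  · exact hne (by rw [(hS₁ y).mp hz p₁ hp₁, zero_mul])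
  · exact hne (by rw [(hS₂ y).mp hz p₂ hp₂, mul_zero])

/-- Irreducible closed subsets of an algebraic set through the origin correspond to primes. -/
def irreducibleClosedsOrderIso {σ κ : Type} [Finite σ] {f : κ → MvPolynomial σ ℂ}
    (hf : ∀ k, eval 0 (f k) = 0) :
    {Z : IrreducibleCloseds (AffZeros f) // AffZeros.origin hf ∈ Z} ≃o
      (PrimesAtOrigin (Ideal.span (Set.range f)))ᵒᵈ where
  toFun Z := OrderDual.toDual ⟨⟨vanishingIdeal ℂ (Subtype.val '' (Z.1 : Set (AffZeros f))),
      isPrime_vanishingIdeal_image Z.1.isIrreducible⟩,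
    Ideal.span_le.mpr (by
      rintro _ ⟨k, rfl⟩
      exact mem_vanishingIdeal_image.mpr fun y _ => y.2 k),
    fun p (hp : p ∈ vanishingIdeal ℂ (Subtype.val '' (Z.1 : Set (AffZeros f)))) => by
      have h := mem_vanishingIdeal_image.mp hp (AffZeros.origin hf) Z.2
      exact mem_originIdeal.mpr h⟩
  invFun P := ⟨{
    carrier := {y | ∀ p ∈ (OrderDual.ofDual P).1.asIdeal, eval y.1 p = 0}
    isIrreducible' := isIrreducible_zeros hf (OrderDual.ofDual P)
    isClosed' := isClosed_affZeros_iff.mpr ⟨_, fun y => Iff.rfl⟩ },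
    fun p hp => mem_originIdeal.mp ((OrderDual.ofDual P).2.2 hp)⟩
  left_inv Z := by
    refine Subtype.ext (IrreducibleCloseds.ext (Set.ext fun y => ?_))
    obtain ⟨S, hS⟩ := isClosed_affZeros_iff.mp Z.1.isClosed
    constructor
    · intro h
      exact (hS y).mpr fun p hp => h p
        (mem_vanishingIdeal_image.mpr fun z hz => (hS z).mp hz p hp)
    · intro h p hp
      exact mem_vanishingIdeal_image.mp hp y h
  right_inv P := by
    refine Subtype.ext (PrimeSpectrum.ext (Ideal.ext fun p => ?_))
    constructor
    · intro h
      by_contra hp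
      obtain ⟨y, hy, hne⟩ := exists_eval_ne_zero_of_notMem_prime (OrderDual.ofDual P).2.1 hp
      exact hne (mem_vanishingIdeal_image.mp h y hy)
    · intro h
      exact mem_vanishingIdeal_image.mpr fun y hy => hy p h
  map_rel_iff' {Z W} := by
    constructor
    · intro h y hy
      obtain ⟨S, hS⟩ := isClosed_affZeros_iff.mp W.1.isClosed
      exact (hS y).mpr fun p hp => mem_vanishingIdeal_image.mp (h (x := p)
        (mem_vanishingIdeal_image.mpr fun z hz => (hS z).mp hz p hp)) y hy
    · intro h p hp
      exact mem_vanishingIdeal_image.mpr fun y hy => mem_vanishingIdeal_image.mp hp y (h hy)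

lemma krullDim_irreducibleCloseds_origin {σ κ : Type} [Finite σ] {f : κ → MvPolynomial σ ℂ}
    (hf : ∀ k, eval 0 (f k) = 0) :
    Order.krullDim {Z : IrreducibleCloseds (AffZeros f) // AffZeros.origin hf ∈ Z} =
      Order.krullDim (PrimesAtOrigin (Ideal.span (Set.range f))) := by
  rw [Order.krullDim_eq_of_orderIso (irreducibleClosedsOrderIso hf), Order.krullDim_orderDual]

lemma krullDim_primesAtOrigin_le {σ κ : Type} [Finite σ] {f : κ → MvPolynomial σ ℂ}
    (hf : ∀ k, eval 0 (f k) = 0) {X : Type} [TopologicalSpace X] {ψ : AffZeros f → X}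
    (hψ : Topology.IsInducing ψ) :
    Order.krullDim (PrimesAtOrigin (Ideal.span (Set.range f))) ≤ topologicalKrullDim X := by
  rw [← krullDim_irreducibleCloseds_origin hf]
  exact (Order.krullDim_le_of_strictMono _ (Subtype.strictMono_coe _)).trans
    hψ.topologicalKrullDim_le

/-- The local dimension at a point can be computed in an affine chart. -/
lemma krullDim_irreducibleCloseds_le {σ κ : Type} [Finite σ] {f : κ → MvPolynomial σ ℂ}
    (hf : ∀ k, eval 0 (f k) = 0) {X : Type} [TopologicalSpace X] {ψ : AffZeros f → X}
    (hψ : Topology.IsOpenEmbedding ψ) {x : X} (hx : ψ (AffZeros.origin hf) = x) :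
    Order.krullDim {Z : IrreducibleCloseds X // x ∈ Z} ≤
      Order.krullDim (PrimesAtOrigin (Ideal.span (Set.range f))) := by
  rw [← krullDim_irreducibleCloseds_origin hf]
  let E := IrreducibleCloseds.orderIsoOfIsOpenEmbedding ψ hψ
  have hne : ∀ Z : {Z : IrreducibleCloseds X // x ∈ Z}, (ψ ⁻¹' (Z.1 : Set X)).Nonempty :=
    fun Z => ⟨AffZeros.origin hf, by
      rw [Set.mem_preimage, hx]; exact Z.2⟩
  refine Order.krullDim_le_of_strictMono (fun Z => ⟨E.symm ⟨Z.1, hne Z⟩, ?_⟩) ?_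
  · change ψ _ ∈ Z.1
    rw [hx]
    exact Z.2
  · intro Z W h
    exact E.symm.strictMono (a := ⟨Z.1, hne Z⟩) (b := ⟨W.1, hne W⟩) h

lemma topologicalKrullDim_le_of_forall {X : Type} [TopologicalSpace X] {n : WithBot ℕ∞}
    (h : ∀ x : X, Order.krullDim {Z : IrreducibleCloseds X // x ∈ Z} ≤ n) :
    topologicalKrullDim X ≤ n := by
  refine iSup_le fun p => ?_
  obtain ⟨x, hx⟩ := p.head.isIrreducible.nonempty
  let q : LTSeries {Z : IrreducibleCloseds X // x ∈ Z} :=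
    ⟨p.length, fun i => ⟨p i, (LTSeries.head_le p i) hx⟩, fun i => p.step i⟩
  exact (Order.LTSeries.length_le_krullDim q).trans (h x)

end AffineSets

/-! ### First order expansions at the origin -/

section Jets

open MvPolynomial

variable {ρ : Type} [Fintype ρ] [DecidableEq ρ]

/-- The function `φ` is polynomial, with value `c` and linear part `L` at the origin. -/
def HasJet (φ : (ρ → ℂ) → ℂ) (c : ℂ) (L : (ρ → ℂ) → ℂ) : Prop :=
  ∃ (q : MvPolynomial ρ ℂ) (l : (ρ → ℂ) →ₗ[ℂ] ℂ), (∀ x, eval x q = φ x) ∧ (∀ x, l x = L x) ∧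
    q - C c - linPoly l ∈ originIdeal ρ ^ 2

lemma HasJet.const (c : ℂ) : HasJet (fun _ : ρ → ℂ => c) c (fun _ => 0) :=
  ⟨C c, 0, fun x => by simp, fun x => by simp, by simp⟩

lemma HasJet.linear (l : (ρ → ℂ) →ₗ[ℂ] ℂ) : HasJet (fun x => l x) 0 (fun x => l x) :=
  ⟨linPoly l, l, eval_linPoly l, fun x => rfl, by simp⟩

lemma HasJet.add {φ φ' : (ρ → ℂ) → ℂ} {c c' : ℂ} {L L' : (ρ → ℂ) → ℂ} (h : HasJet φ c L)
    (h' : HasJet φ' c' L') :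
    HasJet (fun x => φ x + φ' x) (c + c') (fun x => L x + L' x) := by
  obtain ⟨q, l, h1, h2, h3⟩ := h
  obtain ⟨q', l', h1', h2', h3'⟩ := h'
  refine ⟨q + q', l + l', fun x => by simp [h1, h1'], fun x => by simp [h2, h2'], ?_⟩
  convert add_mem h3 h3' using 1
  rw [map_add, map_add]
  ring

lemma HasJet.mul {φ φ' : (ρ → ℂ) → ℂ} {c c' : ℂ} {L L' : (ρ → ℂ) → ℂ} (h : HasJet φ c L)
    (h' : HasJet φ' c' L') :
    HasJet (fun x => φ x * φ' x) (c * c') (fun x => c * L' x + L x * c') := by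
  obtain ⟨q, l, h1, h2, h3⟩ := h
  obtain ⟨q', l', h1', h2', h3'⟩ := h'
  refine ⟨q * q', c • l' + c' • l, fun x => by simp [h1, h1'],
    fun x => by simp [h2, h2', mul_comm], ?_⟩
  have hl : ∀ m : (ρ → ℂ) →ₗ[ℂ] ℂ, linPoly m ∈ originIdeal ρ := fun m => by
    rw [mem_originIdeal, eval_linPoly, map_zero]
  have h4 : linPoly l * linPoly l' ∈ originIdeal ρ ^ 2 := by
    rw [pow_two]
    exact Ideal.mul_mem_mul (hl _) (hl _)
  convert add_mem (add_mem h4 (Ideal.mul_mem_left _ (C c + linPoly l) h3'))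
    (Ideal.mul_mem_right q' _ h3) using 1
  rw [map_add, map_smul, map_smul, smul_eq_C_mul, smul_eq_C_mul, map_mul]
  ring

lemma HasJet.sum {ι : Type} (s : Finset ι) {φ : ι → (ρ → ℂ) → ℂ} {c : ι → ℂ}
    {L : ι → (ρ → ℂ) → ℂ} (h : ∀ i, HasJet (φ i) (c i) (L i)) :
    HasJet (fun x => ∑ i ∈ s, φ i x) (∑ i ∈ s, c i) (fun x => ∑ i ∈ s, L i x) := by
  classical
  induction s using Finset.induction_on with
  | empty => simpa using HasJet.const (ρ := ρ) 0
  | insert a s ha ih =>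
    simp only [Finset.sum_insert ha]
    exact (h a).add ih

/-- Entrywise version of `HasJet` for matrix valued functions. -/
def HasMatJet {m n : Type} (Φ : (ρ → ℂ) → Matrix m n ℂ) (B : Matrix m n ℂ)
    (L : (ρ → ℂ) → Matrix m n ℂ) : Prop :=
  ∀ i j, HasJet (fun x => Φ x i j) (B i j) (fun x => L x i j)

lemma HasMatJet.const {m n : Type} (B : Matrix m n ℂ) :
    HasMatJet (fun _ : ρ → ℂ => B) B (fun _ => 0) := fun i j => HasJet.const (B i j)

lemma HasMatJet.add {m n : Type} {Φ Φ' : (ρ → ℂ) → Matrix m n ℂ} {B B' : Matrix m n ℂ}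
    {L L' : (ρ → ℂ) → Matrix m n ℂ} (h : HasMatJet Φ B L) (h' : HasMatJet Φ' B' L') :
    HasMatJet (fun x => Φ x + Φ' x) (B + B') (fun x => L x + L' x) :=
  fun i j => (h i j).add (h' i j)

lemma HasMatJet.mul {l m n : Type} [Fintype m] {Φ : (ρ → ℂ) → Matrix l m ℂ}
    {Φ' : (ρ → ℂ) → Matrix m n ℂ} {B : Matrix l m ℂ} {B' : Matrix m n ℂ}
    {L : (ρ → ℂ) → Matrix l m ℂ} {L' : (ρ → ℂ) → Matrix m n ℂ} (h : HasMatJet Φ B L)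
    (h' : HasMatJet Φ' B' L') :
    HasMatJet (fun x => Φ x * Φ' x) (B * B') (fun x => B * L' x + L x * B') := by
  intro i j
  simp only [Matrix.add_apply, Matrix.mul_apply, ← Finset.sum_add_distrib]
  exact HasJet.sum _ fun k => (h i k).mul (h' k j)

lemma exists_poly_of_hasJet {κ : Type} {Φ : κ → (ρ → ℂ) → ℂ} {D : (ρ → ℂ) →ₗ[ℂ] (κ → ℂ)}
    (h : ∀ k, HasJet (Φ k) 0 (fun x => D x k)) :
    ∃ f : κ → MvPolynomial ρ ℂ, (∀ k x, eval x (f k) = Φ k x) ∧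
      ∀ k, f k - linPoly (LinearMap.proj k ∘ₗ D) ∈ originIdeal ρ ^ 2 := by
  choose f l h1 h2 h3 using h
  refine ⟨f, h1, fun k => ?_⟩
  have : l k = LinearMap.proj k ∘ₗ D := LinearMap.ext (h2 k)
  simpa [this] using h3 k

end Jets

/-! ### Charts of the quiver Grassmannian -/

section Charts

variable {s t : A → V} {d e k : V → ℕ}

/-- The inclusion of the graph of `y`. -/
def graphMat (S : ∀ i, Split (d i) (e i) (k i)) (y : ∀ i, Matrix (Fin (k i)) (Fin (e i)) ℂ)
    (i : V) : Matrix (Fin (d i)) (Fin (e i)) ℂ := (S i).J + (S i).K * y i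

/-- The obstruction for the graph of `y` to be stable under `u`. -/
def graphEq (S : ∀ i, Split (d i) (e i) (k i)) (u : QRep s t d)
    (y : ∀ i, Matrix (Fin (k i)) (Fin (e i)) ℂ) (a : A) :
    Matrix (Fin (k (t a))) (Fin (e (s a))) ℂ :=
  ((S (t a)).R - y (t a) * (S (t a)).P) * u a * graphMat S y (s a)

lemma P_mul_graphMat (S : ∀ i, Split (d i) (e i) (k i))
    (y : ∀ i, Matrix (Fin (k i)) (Fin (e i)) ℂ) (i : V) : (S i).P * graphMat S y i = 1 := by
  rw [graphMat, Matrix.mul_add, ← Matrix.mul_assoc, (S i).PJ, (S i).PK, Matrix.zero_mul, add_zero]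

lemma R_mul_graphMat (S : ∀ i, Split (d i) (e i) (k i))
    (y : ∀ i, Matrix (Fin (k i)) (Fin (e i)) ℂ) (i : V) : (S i).R * graphMat S y i = y i := by
  rw [graphMat, Matrix.mul_add, ← Matrix.mul_assoc, (S i).RJ, (S i).RK, Matrix.one_mul, zero_add]

lemma eq_graphMat_mul {n : Type} (S : ∀ i, Split (d i) (e i) (k i))
    {y : ∀ i, Matrix (Fin (k i)) (Fin (e i)) ℂ} {i : V} {B : Matrix (Fin (d i)) n ℂ}
    (h : (S i).R * B = y i * ((S i).P * B)) : B = graphMat S y i * ((S i).P * B) := by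
  rw [graphMat, Matrix.add_mul, Matrix.mul_assoc _ (y i), ← h, ← Matrix.mul_assoc,
    ← Matrix.mul_assoc, ← Matrix.add_mul, (S i).sum, Matrix.one_mul]

lemma graphEq_eq_zero_iff (S : ∀ i, Split (d i) (e i) (k i)) (u : QRep s t d)
    (y : ∀ i, Matrix (Fin (k i)) (Fin (e i)) ℂ) (a : A) :
    graphEq S u y a = 0 ↔
      ∃ N : Matrix (Fin (e (t a))) (Fin (e (s a))) ℂ,
        u a * graphMat S y (s a) = graphMat S y (t a) * N := by
  rw [graphEq, Matrix.mul_assoc, Matrix.sub_mul, sub_eq_zero, Matrix.mul_assoc]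
  constructor
  · intro h
    exact ⟨_, eq_graphMat_mul S h⟩
  · rintro ⟨N, hN⟩
    rw [hN, ← Matrix.mul_assoc, ← Matrix.mul_assoc _ _ N, R_mul_graphMat, P_mul_graphMat,
      Matrix.one_mul]

/-- The point of the Stiefel variety given by a stable graph. -/
def graphPt (S : ∀ i, Split (d i) (e i) (k i)) {u : QRep s t d} (y : Coord k e)
    (hy : ∀ a, graphEq S u (matOf y) a = 0) : StQ s t u e :=
  ⟨ofMat (graphMat S (matOf y)),
    fun i => injective_of_det_ne_zero (S i).P (by
      rw [matOf_ofMat, P_mul_graphMat, Matrix.det_one]; exact one_ne_zero),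
    fun a => map_range_mulVecLin_le_iff.mpr ((graphEq_eq_zero_iff S u _ a).mp (hy a))⟩

/-- The coordinates of a point of the Stiefel variety in a chart. -/
def chartCoord (S : ∀ i, Split (d i) (e i) (k i)) (F : Coord d e) : Coord k e :=
  ofMat fun i => (S i).R * matOf F i * ((S i).P * matOf F i)⁻¹

lemma graphMat_chartCoord (S : ∀ i, Split (d i) (e i) (k i)) {F : Coord d e} {i : V}
    (hdet : ((S i).P * matOf F i).det ≠ 0) :
    graphMat S (matOf (chartCoord S F)) i = matOf F i * ((S i).P * matOf F i)⁻¹ := by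
  have h : (S i).R * (matOf F i * ((S i).P * matOf F i)⁻¹) = matOf (chartCoord S F) i *
      ((S i).P * (matOf F i * ((S i).P * matOf F i)⁻¹)) := by
    rw [chartCoord, matOf_ofMat, ← Matrix.mul_assoc (S i).P,
      Matrix.mul_nonsing_inv _ (isUnit_iff_ne_zero.mpr hdet), Matrix.mul_one, Matrix.mul_assoc]
  rw [eq_graphMat_mul S h, ← Matrix.mul_assoc (S i).P,
    Matrix.mul_nonsing_inv _ (isUnit_iff_ne_zero.mpr hdet), Matrix.mul_one]

lemma toSub_graphPt_eq_iff (S : ∀ i, Split (d i) (e i) (k i)) {u : QRep s t d} (y : Coord k e)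
    (hy : ∀ a, graphEq S u (matOf y) a = 0) (F : StQ s t u e) :
    toSub s t u e (graphPt S y hy) = toSub s t u e F ↔
      (∀ i, ((S i).P * matOf F.1 i).det ≠ 0) ∧ y = chartCoord S F.1 := by
  constructor
  · intro h
    have hr : ∀ i, LinearMap.range (graphMat S (matOf y) i).mulVecLin =
        LinearMap.range (matOf F.1 i).mulVecLin := fun i => congrFun (congrArg Subtype.val h) i
    have hdet : ∀ i, ((S i).P * matOf F.1 i).det ≠ 0 := by
      intro i
      obtain ⟨B, hB⟩ := range_mulVecLin_le_iff.mp (hr i).le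
      have h1 : (S i).P * matOf F.1 i * B = 1 := by
        rw [Matrix.mul_assoc, ← hB, P_mul_graphMat]
      intro h0
      have := congrArg Matrix.det h1
      rw [Matrix.det_mul, h0, zero_mul, Matrix.det_one] at this
      exact zero_ne_one this
    refine ⟨hdet, ?_⟩
    rw [← ofMat_matOf y, chartCoord]
    congr 1
    funext i
    obtain ⟨B, hB⟩ := range_mulVecLin_le_iff.mp (hr i).ge
    have h2 : (S i).P * matOf F.1 i = B := by
      rw [hB, ← Matrix.mul_assoc, P_mul_graphMat, Matrix.one_mul]
    have h3 : (S i).R * matOf F.1 i = matOf y i * ((S i).P * matOf F.1 i) := by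
      rw [h2, hB, ← Matrix.mul_assoc, R_mul_graphMat]
    rw [h3, Matrix.mul_nonsing_inv_cancel_right _ _ (isUnit_iff_ne_zero.mpr (hdet i))]
  · rintro ⟨hdet, rfl⟩
    refine Subtype.ext (funext fun i => ?_)
    have h1 := graphMat_chartCoord S (hdet i)
    refine le_antisymm (range_mulVecLin_le_iff.mpr ⟨_, h1⟩)
      (range_mulVecLin_le_iff.mpr ⟨(S i).P * matOf F.1 i, ?_⟩)
    change _ = graphMat S (matOf (chartCoord S F.1)) i * _
    rw [h1, Matrix.nonsing_inv_mul_cancel_right _ _ (isUnit_iff_ne_zero.mpr (hdet i))]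

lemma graphEq_chartCoord (S : ∀ i, Split (d i) (e i) (k i)) {u : QRep s t d} (F : StQ s t u e)
    (hdet : ∀ i, ((S i).P * matOf F.1 i).det ≠ 0) (a : A) :
    graphEq S u (matOf (chartCoord S F.1)) a = 0 := by
  obtain ⟨N, hN⟩ := F.exists_restriction
  refine (graphEq_eq_zero_iff S u _ a).mpr
    ⟨((S (t a)).P * matOf F.1 (t a)) * N a * ((S (s a)).P * matOf F.1 (s a))⁻¹, ?_⟩
  rw [graphMat_chartCoord S (hdet (s a)), graphMat_chartCoord S (hdet (t a)), ← Matrix.mul_assoc, hN,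
    ← Matrix.mul_assoc, ← Matrix.mul_assoc,
    Matrix.nonsing_inv_mul_cancel_right _ _ (isUnit_iff_ne_zero.mpr (hdet (t a)))]

end Charts

section ChartTopology

open MvPolynomial

variable {s t : A → V} {d e k : V → ℕ}

/-- The open condition defining the image of a chart. -/
def chartDet [Fintype V] (S : ∀ i, Split (d i) (e i) (k i)) (F : Coord d e) : ℂ :=
  ∏ i, ((S i).P * matOf F i).det

lemma det_mem_regFun (S : ∀ i, Split (d i) (e i) (k i))
    (δ : MvPolynomial (Σ i, Fin (d i) × Fin (e i)) ℂ) (i : V) :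
    (fun F : Coord d e => ((S i).P * matOf F i).det) ∈ regFun δ :=
  det_mem_subalgebra _ fun p q => matrix_mul_mem_subalgebra _ (A := fun _ => (S i).P)
    (fun _ _ => const_mem_subalgebra _ _) (fun p q => coord_mem_regFun δ ⟨i, p, q⟩) p q

lemma exists_poly_chartDet [Fintype V] (S : ∀ i, Split (d i) (e i) (k i)) :
    ∃ δ : MvPolynomial (Σ i, Fin (d i) × Fin (e i)) ℂ, ∀ F, eval F δ = chartDet S F :=
  exists_poly_of_mem_regFun_one (prod_mem_subalgebra _ _ fun i => det_mem_regFun S 1 i)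

lemma chartCoord_mem_regFun [Fintype V] (S : ∀ i, Split (d i) (e i) (k i))
    {δ : MvPolynomial (Σ i, Fin (d i) × Fin (e i)) ℂ} (hδ : ∀ F, eval F δ = chartDet S F)
    (x : Σ i, Fin (k i) × Fin (e i)) : (fun F : Coord d e => chartCoord S F x) ∈ regFun δ := by
  classical
  obtain ⟨i, p, q⟩ := x
  have hinv : (fun F : Coord d e => (((S i).P * matOf F i).det)⁻¹) ∈ regFun δ := by
    obtain ⟨r, hr⟩ := exists_poly_of_mem_regFun_one
      (prod_mem_subalgebra _ (Finset.univ.erase i) fun i => det_mem_regFun S 1 i)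
    refine ⟨1, r, fun F hF => ?_⟩
    rw [hδ, chartDet] at hF
    have := Finset.prod_ne_zero_iff.mp hF i (Finset.mem_univ i)
    rw [hr, hδ, chartDet, ← Finset.mul_prod_erase _ _ (Finset.mem_univ i), pow_one,
      inv_mul_cancel_left₀ this]
  change (fun F : Coord d e => ((S i).R * matOf F i * ((S i).P * matOf F i)⁻¹) p q) ∈ regFun δ
  refine matrix_mul_mem_subalgebra _
    (matrix_mul_mem_subalgebra _ (A := fun _ => (S i).R) (fun _ _ => const_mem_subalgebra _ _)
      (fun p q => coord_mem_regFun δ ⟨i, p, q⟩)) (fun p q => ?_) p q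
  simp only [Matrix.inv_def, Ring.inverse_eq_inv', Matrix.smul_apply, smul_eq_mul]
  exact (regFun δ).mul_mem hinv (adjugate_mem_subalgebra _
    (matrix_mul_mem_subalgebra _ (A := fun _ => (S i).P) (fun _ _ => const_mem_subalgebra _ _)
      (fun p q => coord_mem_regFun δ ⟨i, p, q⟩)) p q)

lemma graphMat_mem_regFun (S : ∀ i, Split (d i) (e i) (k i))
    (δ : MvPolynomial (Σ i, Fin (k i) × Fin (e i)) ℂ) (x : Σ i, Fin (d i) × Fin (e i)) :
    (fun y : Coord k e => ofMat (graphMat S (matOf y)) x) ∈ regFun δ :=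
  (regFun δ).add_mem (const_mem_subalgebra _ ((S x.1).J x.2.1 x.2.2))
    (matrix_mul_mem_subalgebra _ (A := fun _ => (S x.1).K) (fun _ _ => const_mem_subalgebra _ _)
      (fun p q => coord_mem_regFun δ ⟨x.1, p, q⟩) x.2.1 x.2.2)

/-- The chart of the quiver Grassmannian given by graphs. -/
def chart (S : ∀ i, Split (d i) (e i) (k i)) (u : QRep s t d) {κ : Type}
    (f : κ → MvPolynomial (Σ i, Fin (k i) × Fin (e i)) ℂ)
    (hf : ∀ y, (∀ j, eval y (f j) = 0) ↔ ∀ a, graphEq S u (matOf y) a = 0) :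
    AffZeros f → SubRep s t u e := fun y => toSub s t u e (graphPt S y.1 ((hf _).mp y.2))

lemma isOpenEmbedding_chart [Fintype V] (S : ∀ i, Split (d i) (e i) (k i)) (u : QRep s t d)
    {κ : Type} (f : κ → MvPolynomial (Σ i, Fin (k i) × Fin (e i)) ℂ)
    (hf : ∀ y, (∀ j, eval y (f j) = 0) ↔ ∀ a, graphEq S u (matOf y) a = 0) :
    Topology.IsOpenEmbedding (chart S u f hf) := by
  have hkey : ∀ (y : AffZeros f) (F : StQ s t u e), chart S u f hf y = toSub s t u e F ↔
      (∀ i, ((S i).P * matOf F.1 i).det ≠ 0) ∧ y.1 = chartCoord S F.1 := fun y F =>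
    toSub_graphPt_eq_iff S y.1 _ F
  have hinj : Function.Injective (chart S u f hf) := fun y y' h => by
    have h1 := (hkey y (graphPt S y'.1 ((hf _).mp y'.2))).mp h
    have h2 := (hkey y' (graphPt S y'.1 ((hf _).mp y'.2))).mp rfl
    exact Subtype.ext (h1.2.trans h2.2.symm)
  obtain ⟨δ, hδ⟩ := exists_poly_chartDet S
  have hcl : ∀ Z : Set (AffZeros f), IsClosed Z →
      IsClosed {N | ∀ y, chart S u f hf y = N → y ∈ Z} := by
    intro Z hZ
    obtain ⟨T, hT⟩ := isClosed_affZeros_iff.mp hZ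
    choose q hq using fun p : MvPolynomial (Σ i, Fin (k i) × Fin (e i)) ℂ =>
      exists_poly_of_mem_regFun (eval_mem_subalgebra _ (chartCoord_mem_regFun S hδ) p)
    refine isClosed_subRep_iff.mpr ⟨q '' T, fun F => ?_⟩
    rw [Set.forall_mem_image]
    simp only [hq, Set.mem_ofPred_eq, hkey]
    rw [hδ, chartDet]
    constructor
    · intro h p hp
      by_cases hd : ∏ i, ((S i).P * matOf F.1 i).det = 0
      · exact Or.inl hd
      · have hdet : ∀ i, ((S i).P * matOf F.1 i).det ≠ 0 := fun i =>
          Finset.prod_ne_zero_iff.mp hd i (Finset.mem_univ i)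
        exact Or.inr ((hT _).mp (h ⟨chartCoord S F.1,
          (hf _).mpr (graphEq_chartCoord S F hdet)⟩ ⟨hdet, rfl⟩) p hp)
    · rintro h y ⟨hdet, hy⟩
      refine (hT y).mpr fun p hp => ?_
      rw [hy]
      exact (h hp).resolve_left (Finset.prod_ne_zero_iff.mpr fun i _ => hdet i)
  refine .of_continuous_injective_isOpenMap ?_ hinj ?_
  · rw [continuous_iff_isClosed]
    intro C hC
    obtain ⟨T, hT⟩ := isClosed_subRep_iff.mp hC
    choose q hq using fun p : MvPolynomial (Σ i, Fin (d i) × Fin (e i)) ℂ =>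
      exists_poly_of_mem_regFun_one (eval_mem_subalgebra _ (graphMat_mem_regFun S 1) p)
    refine isClosed_affZeros_iff.mpr ⟨q '' T, fun y => ?_⟩
    rw [Set.forall_mem_image]
    simp only [hq]
    exact hT _
  · intro U hU
    rw [← isClosed_compl_iff]
    convert hcl _ hU.isClosed_compl using 1
    ext N
    simp only [Set.mem_compl_iff, Set.mem_image, Set.mem_ofPred_eq, not_exists, not_and]
    exact forall_congr' fun y => ⟨fun h h1 h2 => h h2 h1, fun h h1 h2 => h h2 h1⟩

/-- The linear part of the graph equations. -/
def chartLin (S : ∀ i, Split (d i) (e i) (k i)) (u : QRep s t d) :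
    Coord k e →ₗ[ℂ] ((Σ a : A, Fin (k (t a)) × Fin (e (s a))) → ℂ) where
  toFun y x := ((S (t x.1)).R * u x.1 * (S (s x.1)).K * matOf y (s x.1) -
    matOf y (t x.1) * ((S (t x.1)).P * u x.1 * (S (s x.1)).J)) x.2.1 x.2.2
  map_add' y z := funext fun x => by
    have h : ∀ i, matOf (y + z) i = matOf y i + matOf z i := fun i => rfl
    simp only [h, Matrix.mul_add, Matrix.add_mul, Matrix.sub_apply, Matrix.add_apply, Pi.add_apply]
    ring
  map_smul' c y := funext fun x => by
    have h : ∀ i, matOf (c • y) i = c • matOf y i := fun i => rfl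
    simp only [h, Matrix.mul_smul, Matrix.smul_mul, Matrix.sub_apply, Matrix.smul_apply,
      Pi.smul_apply, RingHom.id_apply, smul_eq_mul]
    ring

lemma hasMatJet_matOf [Fintype V] [DecidableEq V] {ρ : Type} [Fintype ρ] [DecidableEq ρ]
    (r : (Σ i, Fin (k i) × Fin (e i)) → ρ) (i : V) :
    HasMatJet (fun x : ρ → ℂ => matOf (fun z => x (r z) : Coord k e) i) 0
      (fun x => matOf (fun z => x (r z) : Coord k e) i) :=
  fun p q => HasJet.linear (LinearMap.proj (r ⟨i, p, q⟩))

lemma hasMatJet_graphEq {ρ : Type} [Fintype ρ] [DecidableEq ρ]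
    (S : ∀ i, Split (d i) (e i) (k i)) {U : (ρ → ℂ) → QRep s t d} {u : QRep s t d}
    {U' : (ρ → ℂ) → QRep s t d} {Y Y' : (ρ → ℂ) → ∀ i, Matrix (Fin (k i)) (Fin (e i)) ℂ}
    (hU : ∀ a, HasMatJet (fun x => U x a) (u a) (fun x => U' x a))
    (hY : ∀ i, HasMatJet (fun x => Y x i) 0 (fun x => Y' x i))
    (h0 : ∀ a, (S (t a)).R * u a * (S (s a)).J = 0) (a : A) :
    HasMatJet (fun x => graphEq S (U x) (Y x) a) 0
      (fun x => (S (t a)).R * u a * (S (s a)).K * Y' x (s a) -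
        Y' x (t a) * ((S (t a)).P * u a * (S (s a)).J) +
        (S (t a)).R * U' x a * (S (s a)).J) := by
  have h := (((HasMatJet.const (S (t a)).R).add
    ((HasMatJet.const (-1)).mul ((hY (t a)).mul (HasMatJet.const (S (t a)).P)))).mul (hU a)).mul
    ((HasMatJet.const (S (s a)).J).add ((HasMatJet.const (S (s a)).K).mul (hY (s a))))
  convert h using 1
  · funext x
    simp only [graphEq, graphMat, sub_eq_add_neg, Matrix.neg_mul, Matrix.one_mul]
  · simp [h0]
  · funext x
    simp only [Matrix.zero_mul, Matrix.mul_zero, add_zero, zero_add, Matrix.neg_mul,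
      Matrix.one_mul, sub_eq_add_neg, Matrix.mul_assoc, Matrix.add_mul]
    abel

lemma exists_chart_equations [Fintype V] [DecidableEq V] (S : ∀ i, Split (d i) (e i) (k i))
    (u : QRep s t d) (h0 : ∀ a, (S (t a)).R * u a * (S (s a)).J = 0) :
    ∃ f : (Σ a : A, Fin (k (t a)) × Fin (e (s a))) →
        MvPolynomial (Σ i, Fin (k i) × Fin (e i)) ℂ,
      (∀ y, (∀ j, eval y (f j) = 0) ↔ ∀ a, graphEq S u (matOf y) a = 0) ∧
      ∀ j, f j - linPoly (LinearMap.proj j ∘ₗ chartLin S u) ∈ originIdeal _ ^ 2 := by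
  have h : ∀ x : (Σ a : A, Fin (k (t a)) × Fin (e (s a))),
      HasJet (fun y : Coord k e => graphEq S u (matOf y) x.1 x.2.1 x.2.2) 0
        (fun y => chartLin S u y x) := fun x => by
    have h1 := hasMatJet_graphEq S (fun a => HasMatJet.const (u a))
      (hasMatJet_matOf (k := k) (e := e) id) h0 x.1 x.2.1 x.2.2
    convert h1 using 1
    · rfl
    · rfl
    · funext y
      simp only [Matrix.mul_zero, Matrix.zero_mul, add_zero]
      rfl
  obtain ⟨f, hf1, hf2⟩ := exists_poly_of_hasJet h
  refine ⟨f, fun y => ⟨fun h a => ?_, fun h j => ?_⟩, hf2⟩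
  · ext p q
    rw [← hf1 ⟨a, p, q⟩, h]
    rfl
  · rw [hf1, h]
    rfl

end ChartTopology

/-! ### The dimension of the quiver Grassmannian -/

section Dimension

open MvPolynomial

variable {s t : A → V} {d e k : V → ℕ}

lemma Rigid.chartLin_surjective {M : QRep s t d} (hM : Rigid s t M)
    (S : ∀ i, Split (d i) (e i) (k i)) (h0 : ∀ a, (S (t a)).R * M a * (S (s a)).J = 0) :
    Function.Surjective (chartLin S M) := by
  intro c
  let C : ∀ a, Matrix (Fin (k (t a))) (Fin (e (s a))) ℂ := fun a p q => c ⟨a, p, q⟩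
  obtain ⟨f, hf⟩ := hM fun a => (S (t a)).K * C a * (S (s a)).P
  refine ⟨ofMat fun i => (S i).R * f i * (S i).J, funext fun x => ?_⟩
  obtain ⟨a, p, q⟩ := x
  have hfa : M a * f (s a) - f (t a) * M a = (S (t a)).K * C a * (S (s a)).P := congrFun hf a
  have hK : (S (s a)).K * (S (s a)).R = 1 - (S (s a)).J * (S (s a)).P :=
    eq_sub_of_add_eq' (S (s a)).sum
  have hJ : (S (t a)).J * (S (t a)).P = 1 - (S (t a)).K * (S (t a)).R :=
    eq_sub_of_add_eq (S (t a)).sum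
  have h1 : (S (t a)).R * M a * (S (s a)).K * ((S (s a)).R * f (s a) * (S (s a)).J) =
      (S (t a)).R * (M a * f (s a)) * (S (s a)).J := by
    calc _ = (S (t a)).R * M a * ((S (s a)).K * (S (s a)).R) * f (s a) * (S (s a)).J := by
          simp only [Matrix.mul_assoc]
      _ = (S (t a)).R * (M a * f (s a)) * (S (s a)).J -
          ((S (t a)).R * M a * (S (s a)).J) * ((S (s a)).P * f (s a) * (S (s a)).J) := by
          rw [hK]
          simp only [Matrix.mul_sub, Matrix.sub_mul, Matrix.mul_one, Matrix.mul_assoc]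
      _ = _ := by rw [h0, Matrix.zero_mul, sub_zero]
  have h2 : (S (t a)).R * f (t a) * (S (t a)).J * ((S (t a)).P * M a * (S (s a)).J) =
      (S (t a)).R * (f (t a) * M a) * (S (s a)).J := by
    calc _ = (S (t a)).R * f (t a) * ((S (t a)).J * (S (t a)).P) * M a * (S (s a)).J := by
          simp only [Matrix.mul_assoc]
      _ = (S (t a)).R * (f (t a) * M a) * (S (s a)).J -
          (S (t a)).R * f (t a) * (S (t a)).K * ((S (t a)).R * M a * (S (s a)).J) := by
          rw [hJ]
          simp only [Matrix.mul_sub, Matrix.sub_mul, Matrix.mul_one, Matrix.mul_assoc]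
      _ = _ := by rw [h0, Matrix.mul_zero, sub_zero]
  have h3 : (S (t a)).R * M a * (S (s a)).K * ((S (s a)).R * f (s a) * (S (s a)).J) -
      (S (t a)).R * f (t a) * (S (t a)).J * ((S (t a)).P * M a * (S (s a)).J) = C a := by
    rw [h1, h2, ← Matrix.sub_mul, ← Matrix.mul_sub, hfa, ← Matrix.mul_assoc, ← Matrix.mul_assoc,
      (S (t a)).RK, Matrix.one_mul, Matrix.mul_assoc, (S (s a)).PJ, Matrix.mul_one]
  exact congrFun (congrFun h3 p) q

/-- Each point of the quiver Grassmannian is the origin of a chart. -/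
lemma exists_split_eq_chart_origin {M : QRep s t d} (x : SubRep s t M e) :
    ∃ S : ∀ i, Split (d i) (e i) (d i - e i), (∀ a, (S (t a)).R * M a * (S (s a)).J = 0) ∧
      ∀ {κ : Type} (f : κ → MvPolynomial (Σ i, Fin (d i - e i) × Fin (e i)) ℂ)
        (hf : ∀ y, (∀ j, eval y (f j) = 0) ↔ ∀ a, graphEq S M (matOf y) a = 0)
        (h0 : ∀ j, eval 0 (f j) = 0), chart S M f hf (AffZeros.origin h0) = x := by
  choose S hS using fun i => exists_split (x.1 i) (x.2.1 i)
  refine ⟨S, fun a => ?_, fun {κ} f hf h0 => Subtype.ext (funext fun i => ?_)⟩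
  · have h := x.2.2 a
    rw [← hS, ← hS, map_range_mulVecLin_le_iff] at h
    obtain ⟨N, hN⟩ := h
    rw [Matrix.mul_assoc, hN, ← Matrix.mul_assoc, (S (t a)).RJ, Matrix.zero_mul]
  · rw [← hS]
    change LinearMap.range (graphMat S (matOf 0) i).mulVecLin = _
    have : matOf (0 : Coord (fun i => d i - e i) e) i = 0 := rfl
    rw [graphMat, this, Matrix.mul_zero, add_zero]

lemma Rigid.topologicalKrullDim_subRep [Fintype V] [Fintype A] {M : QRep s t d}
    (hM : Rigid s t M) (hne : Nonempty (SubRep s t M e)) :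
    topologicalKrullDim (SubRep s t M e) +
        (((∑ a : A, e (s a) * (d (t a) - e (t a)) : ℕ) : ℕ∞) : WithBot ℕ∞) =
      (((∑ i : V, e i * (d i - e i) : ℕ) : ℕ∞) : WithBot ℕ∞) := by
  classical
  have hσ : Fintype.card (Σ i, Fin (d i - e i) × Fin (e i)) = ∑ i, e i * (d i - e i) := by
    simp [Fintype.card_sigma, mul_comm]
  have hκ : Fintype.card (Σ a, Fin (d (t a) - e (t a)) × Fin (e (s a))) =
      ∑ a, e (s a) * (d (t a) - e (t a)) := by
    simp [Fintype.card_sigma, mul_comm]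
  rw [← hσ, ← hκ]
  have key : ∀ x : SubRep s t M e, ∃ n : WithBot ℕ∞,
      n + Fintype.card (Σ a, Fin (d (t a) - e (t a)) × Fin (e (s a))) =
        Fintype.card (Σ i, Fin (d i - e i) × Fin (e i)) ∧
      n ≤ topologicalKrullDim (SubRep s t M e) ∧
      Order.krullDim {Z : TopologicalSpace.IrreducibleCloseds (SubRep s t M e) // x ∈ Z} ≤ n := by
    intro x
    obtain ⟨S, h0, hS⟩ := exists_split_eq_chart_origin x
    obtain ⟨f, hf, hf'⟩ := exists_chart_equations S M h0
    have hf0 : ∀ j, eval 0 (f j) = 0 := by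
      refine (hf 0).mpr fun a => ?_
      have : ∀ i, matOf (0 : Coord (fun i => d i - e i) e) i = 0 := fun i => rfl
      rw [graphEq, graphMat, this, this, Matrix.zero_mul, sub_zero, Matrix.mul_zero, add_zero, h0]
    have ho := isOpenEmbedding_chart S M f hf
    exact ⟨_, le_antisymm
        (krullDim_add_card_le f _ (hM.chartLin_surjective S h0) hf') (card_le_krullDim_add f hf0),
      krullDim_primesAtOrigin_le hf0 ho.isInducing,
      krullDim_irreducibleCloseds_le hf0 ho (hS f hf hf0)⟩
  obtain ⟨n, h1, h2, -⟩ := key hne.some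
  have : topologicalKrullDim (SubRep s t M e) = n := by
    refine le_antisymm (topologicalKrullDim_le_of_forall fun x => ?_) h2
    obtain ⟨m, h3, -, h4⟩ := key x
    exact h4.trans (ENat.WithBot.add_natCast_cancel.mp (h3.trans h1.symm)).le
  rw [this]
  exact h1

end Dimension

/-! ### Existence of subrepresentations -/

section Nonempty

open MvPolynomial

variable {s t : A → V} {d e : V → ℕ}

lemma Rigid.exists_hom_line [Finite A] {M : QRep s t d} (hM : Rigid s t M) (u : QRep s t d) :
    ∃ γ : ℂ → ∀ i, Matrix (Fin (d i)) (Fin (d i)) ℂ, γ 1 = 1 ∧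
      (∀ τ a, M a * γ τ (s a) = γ τ (t a) * (u a + τ • (M a - u a))) ∧
      ∀ i p q, (fun τ => γ τ i p q) ∈ polyFun := by
  obtain ⟨γ, h1, h2, h3⟩ := exists_hom_curve hM (fun _ => 1)
    (fun a => by rw [Matrix.mul_one, Matrix.one_mul]) (fun a => u a - M a)
  refine ⟨fun τ => γ (1 - τ), ?_, fun τ a => ?_, fun i p q => comp_one_sub_mem_polyFun (h3 i p q)⟩
  · simp only [sub_self, h1]
    rfl
  · rw [h2]
    congr 1
    module

lemma exists_polynomial_of_polyFun {δ : ℂ → ℂ} (hδ : δ ∈ polyFun) {x : ℂ} (hx : δ x ≠ 0) :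
    ∃ P : Polynomial ℂ, P.eval 0 ≠ 0 ∧ ∀ τ, τ ≠ 0 → P.eval τ ≠ 0 → δ τ ≠ 0 := by
  obtain ⟨Q, hQ⟩ := hδ
  have hQ0 : Q ≠ 0 := by
    rintro rfl
    exact hx (by rw [← hQ, Polynomial.eval_zero])
  obtain ⟨P, hP, hdvd⟩ := Q.exists_eq_pow_rootMultiplicity_mul_and_not_dvd hQ0 0
  refine ⟨P, fun h => hdvd (Polynomial.dvd_iff_isRoot.mpr h), fun τ hτ h => ?_⟩
  rw [← hQ, hP, Polynomial.eval_mul, Polynomial.eval_pow]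
  exact mul_ne_zero (pow_ne_zero _ (by simpa using hτ)) h

/-- Deforming a direct sum along a line in the space of representations, the first summand
deforms along, provided that the extension group is trivial. -/
lemma exists_graph_of_extVanish [Fintype V] [Fintype A] {k : V → ℕ}
    (S : ∀ i, Split (d i) (e i) (k i)) {Me : QRep s t e} {Mk : QRep s t k}
    (hext : ExtVanish s t Me Mk) {u : QRep s t d} (hJ : ∀ a, (S (t a)).R * u a * (S (s a)).J = 0)
    (hP : ∀ a, (S (t a)).P * u a * (S (s a)).J = Me a)
    (hR : ∀ a, (S (t a)).R * u a * (S (s a)).K = Mk a) (v : QRep s t d) {P : Polynomial ℂ}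
    (hP0 : P.eval 0 ≠ 0) :
    ∃ (τ : ℂ) (y : Coord k e), τ ≠ 0 ∧ P.eval τ ≠ 0 ∧
      ∀ a, graphEq S (fun a => u a + τ • v a) (matOf y) a = 0 := by
  classical
  let w : (Σ a : A, Fin (k (t a)) × Fin (e (s a))) → ℂ := fun x =>
    ((S (t x.1)).R * v x.1 * (S (s x.1)).J) x.2.1 x.2.2
  let l : (Option (Σ i, Fin (k i) × Fin (e i)) → ℂ) →ₗ[ℂ] ℂ := LinearMap.proj none
  let D : (Option (Σ i, Fin (k i) × Fin (e i)) → ℂ) →ₗ[ℂ]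
      ((Σ a : A, Fin (k (t a)) × Fin (e (s a))) → ℂ) :=
    chartLin S u ∘ₗ LinearMap.funLeft ℂ ℂ some + l.smulRight w
  have hjet : ∀ x : (Σ a : A, Fin (k (t a)) × Fin (e (s a))),
      HasJet (fun y : Option (Σ i, Fin (k i) × Fin (e i)) → ℂ =>
        graphEq S (fun a => u a + y none • v a) (matOf fun z => y (some z)) x.1 x.2.1 x.2.2) 0
        (fun y => D y x) := fun x => by
    have hU : ∀ a, HasMatJet (fun y : Option (Σ i, Fin (k i) × Fin (e i)) → ℂ =>
        u a + y none • v a) (u a) (fun y => y none • v a) := fun a p q => by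
      convert (HasJet.const (u a p q)).add ((HasJet.linear l).mul (HasJet.const (v a p q))) using 1
      · rfl
      · simp
      · funext y
        change y none * v a p q = _
        simp [l]
    have h1 := hasMatJet_graphEq S hU (hasMatJet_matOf (k := k) (e := e) some) hJ x.1 x.2.1 x.2.2
    convert h1 using 1
    · rfl
    · funext y
      simp only [Matrix.mul_smul, Matrix.smul_mul]
      rfl
  obtain ⟨f, hf, hf'⟩ := exists_poly_of_hasJet hjet
  have hsurj : Function.Surjective (D.prod l) := by
    rintro ⟨c, τ⟩
    obtain ⟨z, hz⟩ := hext fun a p q => c ⟨a, p, q⟩ - τ * w ⟨a, p, q⟩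
    refine ⟨fun o => o.elim τ (ofMat z), Prod.ext (funext fun ⟨a, p, q⟩ => ?_) rfl⟩
    have h1 : chartLin S u (ofMat z) ⟨a, p, q⟩ = c ⟨a, p, q⟩ - τ * w ⟨a, p, q⟩ := by
      have := congrFun (congrFun (congrFun hz a) p) q
      rw [← this]
      change ((S (t a)).R * u a * (S (s a)).K * z (s a) -
        z (t a) * ((S (t a)).P * u a * (S (s a)).J)) p q = _
      rw [hP, hR]
      rfl
    change chartLin S u (ofMat z) ⟨a, p, q⟩ + τ * w ⟨a, p, q⟩ = _
    rw [h1, sub_add_cancel]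
  have heval : ∀ x : Option (Σ i, Fin (k i) × Fin (e i)) → ℂ,
      eval x (Polynomial.aeval (X none) P) = P.eval (x none) := fun x => by
    rw [Polynomial.aeval_def, Polynomial.hom_eval₂, eval_X, algebraMap_eq,
      show (eval x).comp C = RingHom.id ℂ from RingHom.ext (eval_C ·)]
    rfl
  obtain ⟨x, h1, h2, h3⟩ := exists_zero_avoiding f (X none) (by simp) D l hsurj hf'
    (by rw [linPoly_proj, sub_self]; exact zero_mem _)
    (Polynomial.aeval (X none) P) (by rw [heval]; exact hP0)
  refine ⟨x none, fun z => x (some z), by simpa using h2, ?_, fun a => ?_⟩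
  · rw [← heval]
    exact h3
  · ext p q
    rw [← hf ⟨a, p, q⟩ x, h1]
    rfl

lemma nonempty_subRep [Fintype V] [Fintype A] (hle : ∀ i, e i ≤ d i) {M : QRep s t d}
    (hM : Rigid s t M) {Me : QRep s t e} {Mk : QRep s t (fun i => d i - e i)}
    (hext : ExtVanish s t Me Mk) : Nonempty (SubRep s t M e) := by
  have hN : ∀ i, ∃ N : Submodule ℂ (Fin (d i) → ℂ), Module.finrank ℂ N = e i := fun i =>
    ⟨_, (finrank_span_eq_card ((Pi.basisFun ℂ (Fin (d i))).linearIndependent.comp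
      (Fin.castLE (hle i)) (Fin.castLE_injective _))).trans (Fintype.card_fin _)⟩
  choose N hN using hN
  choose S _ using fun i => exists_split (N i) (hN i)
  let u : QRep s t d := fun a => (S (t a)).J * Me a * (S (s a)).P + (S (t a)).K * Mk a * (S (s a)).R
  have hu : ∀ {m n : ℕ} (a) (B : Matrix (Fin m) (Fin (d (t a))) ℂ)
      (B' : Matrix (Fin (d (s a))) (Fin n) ℂ), B * u a * B' =
        (B * (S (t a)).J) * Me a * ((S (s a)).P * B') +
        (B * (S (t a)).K) * Mk a * ((S (s a)).R * B') := fun a B B' => by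
    simp only [u, Matrix.mul_add, Matrix.add_mul, Matrix.mul_assoc]
  obtain ⟨γ, h1, h2, h3⟩ := hM.exists_hom_line u
  obtain ⟨P, hP0, hP⟩ := exists_polynomial_of_polyFun (δ := fun τ => ∏ i, (γ τ i).det) (x := 1)
    (prod_mem_subalgebra _ _ fun i => det_mem_subalgebra _ (h3 i)) (by simp [h1])
  obtain ⟨τ, y, hτ, hPτ, hy⟩ := exists_graph_of_extVanish S hext (u := u)
    (fun a => by simp [hu, (S (s a)).PJ, (S (s a)).RJ, (S (t a)).RJ])
    (fun a => by simp [hu, (S (s a)).PJ, (S (s a)).RJ, (S (t a)).PJ])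
    (fun a => by simp [hu, (S (s a)).PK, (S (s a)).RK, (S (t a)).RK])
    (fun a => M a - u a) hP0
  have hdet : ∀ i, (γ τ i).det ≠ 0 := fun i =>
    Finset.prod_ne_zero_iff.mp (hP τ hτ hPτ) i (Finset.mem_univ i)
  refine ⟨toSub s t M e ⟨ofMat fun i => γ τ i * graphMat S (matOf y) i, fun i => ?_, fun a => ?_⟩⟩
  · refine injective_of_det_ne_zero ((S i).P * (γ τ i)⁻¹) ?_
    rw [matOf_ofMat, Matrix.mul_assoc,
      Matrix.nonsing_inv_mul_cancel_left _ _ (isUnit_iff_ne_zero.mpr (hdet i)), P_mul_graphMat,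
      Matrix.det_one]
    exact one_ne_zero
  · obtain ⟨C, hC⟩ := (graphEq_eq_zero_iff S _ _ a).mp (hy a)
    refine map_range_mulVecLin_le_iff.mpr ⟨C, ?_⟩
    rw [matOf_ofMat, matOf_ofMat, ← Matrix.mul_assoc, h2, Matrix.mul_assoc, Matrix.mul_assoc, ← hC]

end Nonempty

/-- If `Ext¹(M̃_e, M̃_{d−e}) = 0` then `Gr_e(M̃_d)` is smooth and
irreducible of dimension `⟨e, d−e⟩`. -/
theorem subRep_rigid_smooth_irreducible [Fintype V] [Fintype A] (s t : A → V)
    (hQ : IsDynkin s t) (d e : V → ℕ) (hle : ∀ i, e i ≤ d i)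
    (Md : QRep s t d) (Me : QRep s t e) (Mde : QRep s t (fun i => d i - e i))
    (hMd : Rigid s t Md) (hMe : Rigid s t Me) (hMde : Rigid s t Mde)
    (hext : ExtVanish s t Me Mde) :
    IrreducibleSpace (SubRep s t Md e) ∧
    (topologicalKrullDim (SubRep s t Md e) +
        (((∑ a : A, e (s a) * (d (t a) - e (t a)) : ℕ) : ℕ∞) : WithBot ℕ∞) =
      (((∑ i : V, e i * (d i - e i) : ℕ) : ℕ∞) : WithBot ℕ∞)) ∧
    ∀ x : SubRep s t Md e,
      Module.finrank ℂ (TangentSp s t Md x) + ∑ a : A, e (s a) * (d (t a) - e (t a)) =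
        ∑ i : V, e i * (d i - e i) := by
  have hne := nonempty_subRep hle hMd hext
  have := hMd.preirreducibleSpace_subRep e
  exact ⟨⟨hne⟩, hMd.topologicalKrullDim_subRep hne, hMd.finrank_tangentSp⟩

end
end

section
/- Let 0 → τM → E → M → 0 be an almost split sequence of representations of a Dynkin quiver Q. Then the quiver Grassmannian Gr_{dim M}(E) is empty, and the quiver Grassmannian Gr_{dim M}(M ⊕ τM) consists of exactly one point (the canonical embedding of M), which is moreover reduced. -/
/-!
STATEMENT 11: Let `0 → τM → E → M → 0` be an almost split sequence of representations
of a Dynkin quiver Q over ℂ.  Then the quiver Grassmannian `Gr_{dim M}(E)` is empty,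
and `Gr_{dim M}(M ⊕ τM)` consists of exactly one point — the canonical embedding of M
— which is moreover reduced (its tangent space is zero).

A quiver is Dynkin iff its Tits form is positive definite.  The canonical embedding
of `M` into `M ⊕ τM` corresponds to the family of subspaces given by the ranges of
the canonical inclusions `ℂ^{dM i} → ℂ^{dM i + dT i}`.
-/

noncomputable section
open Matrix

variable {V A : Type}

/-- A representation is indecomposable: nonzero, and its only idempotent
endomorphisms are 0 and 1. -/
def Indec (s t : A → V) {d : V → ℕ} (M : QRep s t d) : Prop :=
  (∃ i, 0 < d i) ∧
  ∀ φ : RHom s t M M, (∀ i, φ.1 i * φ.1 i = φ.1 i) →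
    (∀ i, φ.1 i = 0) ∨ (∀ i, φ.1 i = 1)

/-- The direct sum of two representations. -/
def dsum (s t : A → V) {d e : V → ℕ} (M : QRep s t d) (N : QRep s t e) :
    QRep s t (fun i => d i + e i) :=
  fun a => Matrix.reindex finSumFinEquiv finSumFinEquiv
    (Matrix.fromBlocks (M a) 0 0 (N a))

/-- `0 → X → Y → Z → 0` is a short exact sequence of representations. -/
def IsSES (s t : A → V) {dX dY dZ : V → ℕ}
    {X : QRep s t dX} {Y : QRep s t dY} {Z : QRep s t dZ}
    (f : RHom s t X Y) (g : RHom s t Y Z) : Prop :=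
  (∀ i, Function.Injective (f.1 i).mulVecLin) ∧
  (∀ i, Function.Surjective (g.1 i).mulVecLin) ∧
  ∀ i, LinearMap.range (f.1 i).mulVecLin = LinearMap.ker (g.1 i).mulVecLin

/-- A morphism of representations is a split epimorphism. -/
def IsSplitEpi (s t : A → V) {dX dY : V → ℕ}
    {X : QRep s t dX} {Y : QRep s t dY} (h : RHom s t X Y) : Prop :=
  ∃ r : RHom s t Y X, ∀ i, h.1 i * r.1 i = 1

/-- `0 → T → E → M → 0` is an almost split (Auslander–Reiten) sequence: it is a
non-split short exact sequence, T and M are indecomposable, and every morphism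
`X → M` which is not a split epimorphism factors through `E`. -/
def IsAlmostSplit (s t : A → V) {dT dE dM : V → ℕ}
    {T : QRep s t dT} {E : QRep s t dE} {M : QRep s t dM}
    (f : RHom s t T E) (g : RHom s t E M) : Prop :=
  IsSES s t f g ∧ ¬ IsSplitEpi s t g ∧ Indec s t T ∧ Indec s t M ∧
  ∀ (x : V → ℕ) (X : QRep s t x) (h : RHom s t X M), ¬ IsSplitEpi s t h →
    ∃ u : RHom s t X E, ∀ i, g.1 i * u.1 i = h.1 i

/-- The canonical inclusion matrix `ℂ^m → ℂ^{m+n}` (first block of columns of the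
identity matrix). -/
def inclMat (m n : ℕ) : Matrix (Fin (m + n)) (Fin m) ℂ :=
  (1 : Matrix (Fin (m + n)) (Fin (m + n)) ℂ).submatrix id (Fin.castAdd n)
/-- A finite-dimensional complex representation of the quiver `(V, A, s, t)` on arbitrary
vector spaces. -/
structure LinRep (s t : A → V) where
  /-- The vector space at a vertex. -/
  space : V → Type
  [addCommGroup : ∀ i, AddCommGroup (space i)]
  [module : ∀ i, Module ℂ (space i)]
  [finiteDimensional : ∀ i, FiniteDimensional ℂ (space i)]
  /-- The linear map at an arrow. -/
  map : ∀ a, space (s a) →ₗ[ℂ] space (t a)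

attribute [instance] LinRep.addCommGroup LinRep.module LinRep.finiteDimensional

/-- Over a field, `h` factors through `q` as soon as `ker q ≤ ker h`. -/
theorem LinearMap.exists_factor_of_ker {E F G : Type*} [AddCommGroup E] [Module ℂ E]
    [AddCommGroup F] [Module ℂ F] [AddCommGroup G] [Module ℂ G]
    (q : E →ₗ[ℂ] F) (h : E →ₗ[ℂ] G) (H : ∀ v, q v = 0 → h v = 0) :
    ∃ k : F →ₗ[ℂ] G, ∀ v, k (q v) = h v := by
  obtain ⟨r, hr⟩ := q.rangeRestrict.exists_rightInverse_of_surjective q.range_rangeRestrict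
  obtain ⟨k, hk⟩ := (h ∘ₗ r).exists_extend
  refine ⟨k, fun v => ?_⟩
  have h1 : k (q v) = h (r (q.rangeRestrict v)) := LinearMap.congr_fun hk (q.rangeRestrict v)
  have h2 : q (r (q.rangeRestrict v)) = q v :=
    congrArg Subtype.val (LinearMap.congr_fun hr (q.rangeRestrict v))
  rw [h1, ← sub_eq_zero, ← map_sub]
  exact H _ (by rw [map_sub, h2, sub_self])

/-- Over a field, `h` lifts along `q` as soon as `range h ≤ range q`. -/
theorem LinearMap.exists_lift_of_range {E F G : Type*} [AddCommGroup E] [Module ℂ E]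
    [AddCommGroup F] [Module ℂ F] [AddCommGroup G] [Module ℂ G]
    (q : E →ₗ[ℂ] F) (h : G →ₗ[ℂ] F) (H : ∀ v, ∃ w, q w = h v) :
    ∃ k : G →ₗ[ℂ] E, ∀ v, q (k v) = h v := by
  obtain ⟨r, hr⟩ := q.rangeRestrict.exists_rightInverse_of_surjective q.range_rangeRestrict
  refine ⟨r ∘ₗ h.codRestrict (LinearMap.range q) H, fun v => ?_⟩
  exact congrArg Subtype.val (LinearMap.congr_fun hr (h.codRestrict (LinearMap.range q) H v))

namespace LinRep

variable {s t : A → V} {X Y Z : LinRep s t}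

/-- A family of linear maps between the spaces of two representations. -/
abbrev Family (X Y : LinRep s t) : Type := ∀ i, X.space i →ₗ[ℂ] Y.space i

/-- The family `f` is a morphism of representations. -/
def IsHom (f : Family X Y) : Prop := ∀ a v, Y.map a (f (s a) v) = f (t a) (X.map a v)

/-- The linear map whose kernel is `Hom(X, Y)` and whose cokernel is `Ext¹(X, Y)`. -/
def coboundary (X Y : LinRep s t) :
    Family X Y →ₗ[ℂ] (∀ a, X.space (s a) →ₗ[ℂ] Y.space (t a)) where
  toFun f a := Y.map a ∘ₗ f (s a) - f (t a) ∘ₗ X.map a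
  map_add' f g := by ext a v; simp; abel
  map_smul' c f := by ext a v; simp [smul_sub]

/-- `Ext¹(X, Y) = 0`. -/
def ExtZero (X Y : LinRep s t) : Prop := Function.Surjective (coboundary X Y)

/-- `Hom(X, Y) = 0`. -/
def HomZero (X Y : LinRep s t) : Prop := ∀ f : Family X Y, IsHom f → ∀ i, f i = 0

theorem coboundary_apply (f : Family X Y) (a : A) (v : X.space (s a)) :
    coboundary X Y f a v = Y.map a (f (s a) v) - f (t a) (X.map a v) := rfl

theorem mem_ker_coboundary {f : Family X Y} :
    f ∈ LinearMap.ker (coboundary X Y) ↔ IsHom f := by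
  simp only [LinearMap.mem_ker, funext_iff, LinearMap.ext_iff, coboundary_apply, Pi.zero_apply,
    LinearMap.zero_apply, sub_eq_zero, IsHom]

theorem IsHom.comp {f : Family X Y} {g : Family Y Z} (hg : IsHom g) (hf : IsHom f) :
    IsHom (fun i => g i ∘ₗ f i : Family X Z) := fun a v => by
  simp [hg a, hf a]

theorem IsHom.sub {f g : Family X Y} (hf : IsHom f) (hg : IsHom g) :
    IsHom (fun i => f i - g i : Family X Y) := fun a v => by
  simp [hf a, hg a]

theorem isHom_id : IsHom (fun _ => LinearMap.id : Family X X) := fun _ _ => rfl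

/-- A representation is indecomposable: nonzero, without nontrivial idempotent endomorphisms. -/
def IsIndec (X : LinRep s t) : Prop :=
  (∃ i, Nontrivial (X.space i)) ∧
  ∀ p : Family X X, IsHom p → (∀ i v, p i (p i v) = p i v) →
    (∀ i v, p i v = 0) ∨ (∀ i v, p i v = v)

/-- The subrepresentation on a stable family of subspaces. -/
abbrev sub (X : LinRep s t) (U : ∀ i, Submodule ℂ (X.space i))
    (hU : ∀ a, ∀ v ∈ U (s a), X.map a v ∈ U (t a)) : LinRep s t where
  space i := U i
  map a := (X.map a).restrict (hU a)

/-- The quotient representation by a stable family of subspaces. -/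
abbrev quot (X : LinRep s t) (U : ∀ i, Submodule ℂ (X.space i))
    (hU : ∀ a, ∀ v ∈ U (s a), X.map a v ∈ U (t a)) : LinRep s t where
  space i := X.space i ⧸ U i
  map a := Submodule.mapQ (U (s a)) (U (t a)) (X.map a) (hU a)

/-- The dimension vector. -/
def dim (X : LinRep s t) (i : V) : ℕ := Module.finrank ℂ (X.space i)

theorem finrank_family_sub [Fintype V] [Fintype A] (X Y : LinRep s t) :
    (Module.finrank ℂ (Family X Y) : ℤ)
      - Module.finrank ℂ (∀ a, X.space (s a) →ₗ[ℂ] Y.space (t a))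
      = eulerForm s t (fun i => X.dim i) (fun i => Y.dim i) := by
  simp [Module.finrank_pi_fintype, Module.finrank_linearMap, eulerForm, dim]

theorem eulerForm_pos_of_extZero [Fintype V] [Fintype A] (h : ExtZero X Y) {f : Family X Y}
    (hf : IsHom f) (hf0 : f ≠ 0) :
    0 < eulerForm s t (fun i => X.dim i) (fun i => Y.dim i) := by
  rw [← finrank_family_sub]
  have h1 := (coboundary X Y).finrank_range_add_finrank_ker
  rw [LinearMap.range_eq_top.2 h, finrank_top] at h1
  have : Nontrivial (LinearMap.ker (coboundary X Y)) :=
    ⟨⟨⟨f, mem_ker_coboundary.2 hf⟩, 0, fun h => hf0 (congrArg Subtype.val h)⟩⟩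
  have h2 : 0 < Module.finrank ℂ (LinearMap.ker (coboundary X Y)) := Module.finrank_pos
  omega

theorem eulerForm_nonpos_of_homZero [Fintype V] [Fintype A] (h : HomZero X Y) :
    eulerForm s t (fun i => X.dim i) (fun i => Y.dim i) ≤ 0 := by
  rw [← finrank_family_sub]
  have h1 : Function.Injective (coboundary X Y) := by
    rw [← LinearMap.ker_eq_bot, eq_bot_iff]
    exact fun f hf => funext (h f (mem_ker_coboundary.1 hf))
  have h2 := LinearMap.finrank_le_finrank_of_injective h1
  omega

/-- In a Dynkin quiver a representation with only scalar endomorphisms is rigid. -/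
theorem extZero_of_brick [Fintype V] [Fintype A] (hQ : IsDynkin s t)
    (hX : ∃ i, Nontrivial (X.space i))
    (hb : ∀ f : Family X X, IsHom f → ∃ c : ℂ, ∀ i v, f i v = c • v) : ExtZero X X := by
  have h0 : (fun i => (X.dim i : ℤ)) ≠ 0 := fun h => by
    obtain ⟨i, hi⟩ := hX
    have h1 : 0 < X.dim i := Module.finrank_pos
    have h2 : (X.dim i : ℤ) = 0 := congrFun h i
    omega
  have hq := hQ _ h0
  rw [← finrank_family_sub] at hq
  have h1 := (coboundary X X).finrank_range_add_finrank_ker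
  have hker : LinearMap.ker (coboundary X X) ≤
      Submodule.span ℂ {(fun _ => LinearMap.id : Family X X)} := fun f hf => by
    obtain ⟨c, hc⟩ := hb f (mem_ker_coboundary.1 hf)
    refine Submodule.mem_span_singleton.2 ⟨c, ?_⟩
    ext i v
    simp [hc]
  have h2 := (Submodule.finrank_mono hker).trans (finrank_span_le_card _)
  have h3 := Submodule.finrank_le (LinearMap.range (coboundary X X))
  simp only [Set.toFinset_singleton, Finset.card_singleton] at h2
  exact LinearMap.range_eq_top.1 (Submodule.eq_top_of_finrank_eq (by omega))

theorem IsIndec.eq_bot_or_eq_top (hX : IsIndec X) {U U' : ∀ i, Submodule ℂ (X.space i)}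
    (hU : ∀ a, ∀ v ∈ U (s a), X.map a v ∈ U (t a))
    (hU' : ∀ a, ∀ v ∈ U' (s a), X.map a v ∈ U' (t a)) (hc : ∀ i, IsCompl (U i) (U' i)) :
    (∀ i, U i = ⊥) ∨ (∀ i, U i = ⊤) := by
  have key : ∀ i v, ∃ u ∈ U i, ∃ u' ∈ U' i, u + u' = v := fun i v =>
    Submodule.mem_sup.1 ((hc i).sup_eq_top ▸ Submodule.mem_top)
  have hp : ∀ i, ∀ u ∈ U i, ∀ u' ∈ U' i, (U i).projection (U' i) (hc i) (u + u') = u :=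
    fun i u hu u' hu' => by
      rw [map_add, Submodule.projection_apply_of_mem_left _ hu,
        (Submodule.projection_apply_eq_zero_iff (hc i)).2 hu', add_zero]
  refine (hX.2 (fun i => (U i).projection (U' i) (hc i)) ?_ ?_).imp
    (fun h i => ?_) (fun h i => ?_)
  · intro a v
    obtain ⟨u, hu, u', hu', rfl⟩ := key _ v
    rw [hp _ u hu u' hu', map_add, hp _ _ (hU a u hu) _ (hU' a u' hu')]
  · intro i v
    exact Submodule.projection_apply_of_mem_left _ (Submodule.projection_apply_mem _ _)
  · rw [eq_bot_iff]
    intro u hu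
    rw [Submodule.mem_bot, ← h i u, Submodule.projection_apply_of_mem_left _ hu]
  · rw [eq_top_iff]
    intro v _
    rw [← h i v]
    exact Submodule.projection_apply_mem _ _

theorem IsHom.pow {f : Family X X} (hf : IsHom f) (n : ℕ) :
    IsHom (fun i => (f i : Module.End ℂ (X.space i)) ^ n : Family X X) := by
  induction n with
  | zero => exact isHom_id
  | succ n ih =>
    intro a v
    simp only [pow_succ, Module.End.mul_apply]
    rw [← hf a, ← ih a]

/-- Fitting's lemma: a non-injective endomorphism of an indecomposable representation is
nilpotent. -/
theorem IsIndec.nilpotent [Fintype V] (hX : IsIndec X) {f : Family X X} (hf : IsHom f)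
    {i : V} {v : X.space i} (hv : v ≠ 0) (hfv : f i v = 0) :
    ∃ n, ∀ i, (f i : Module.End ℂ (X.space i)) ^ n = 0 := by
  obtain ⟨n, hn, hn1⟩ := ((Filter.eventually_all.2 fun i =>
    LinearMap.eventually_isCompl_ker_pow_range_pow (f i)).and
    (Filter.eventually_ge_atTop 1)).exists
  have hpow := hf.pow n
  rcases hX.eq_bot_or_eq_top (U := fun i => LinearMap.ker ((f i : Module.End ℂ (X.space i)) ^ n))
    (U' := fun i => LinearMap.range ((f i : Module.End ℂ (X.space i)) ^ n))
    (fun a v hv => by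
      rw [LinearMap.mem_ker] at hv ⊢
      rw [← hpow a, hv, map_zero])
    (fun a v hv => by
      obtain ⟨w, rfl⟩ := hv
      exact ⟨_, (hpow a w).symm⟩) hn with h | h
  · refine absurd ?_ hv
    have : v ∈ LinearMap.ker ((f i : Module.End ℂ (X.space i)) ^ n) := by
      obtain ⟨m, rfl⟩ := Nat.exists_eq_add_of_le' hn1
      rw [LinearMap.mem_ker, pow_succ, Module.End.mul_apply, hfv, map_zero]
    rw [h i] at this
    simpa using this
  · exact ⟨n, fun i => LinearMap.ker_eq_top.1 (h i)⟩

/-- A nonempty class of families contains one whose kernels are maximal. -/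
theorem exists_maximal_ker [Fintype V] (P : Family X Y → Prop) (hP : ∃ f, P f) :
    ∃ f, P f ∧ ∀ g, P g → (∀ i v, f i v = 0 → g i v = 0) → ∀ i v, g i v = 0 → f i v = 0 := by
  obtain ⟨f, hf, hmin⟩ := exists_minimalFor_of_wellFoundedLT P
    (fun f => ∑ i, Module.finrank ℂ (LinearMap.range (f i))) hP
  refine ⟨f, hf, fun g hg hfg i v hv => ?_⟩
  have hle : ∀ i, LinearMap.ker (f i) ≤ LinearMap.ker (g i) := fun i v hv => hfg i v hv
  have hrank : ∀ i ∈ Finset.univ, Module.finrank ℂ (LinearMap.range (g i)) ≤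
      Module.finrank ℂ (LinearMap.range (f i)) := fun i _ => by
    have h1 := (f i).finrank_range_add_finrank_ker
    have h2 := (g i).finrank_range_add_finrank_ker
    have h3 := Submodule.finrank_mono (hle i)
    omega
  have hsum := le_antisymm (Finset.sum_le_sum hrank) (hmin hg (Finset.sum_le_sum hrank))
  have heq := (Finset.sum_eq_sum_iff_of_le hrank).1 hsum i (Finset.mem_univ i)
  have h1 := (f i).finrank_range_add_finrank_ker
  have h2 := (g i).finrank_range_add_finrank_ker
  have hker := Submodule.eq_of_le_of_finrank_le (hle i) (by omega)
  change v ∈ LinearMap.ker (f i)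
  rw [hker]
  exact hv

/-- Some indecomposable direct summand of `N` is not annihilated by the projection of a given
family of vectors. -/
theorem exists_indec_summand [Fintype V] (N : LinRep s t) (S : ∀ i, N.space i → Prop)
    (hS : ∃ i x, S i x ∧ x ≠ 0) :
    ∃ (K : LinRep s t) (ι : Family K N) (π : Family N K), IsHom ι ∧ IsHom π ∧
      (∀ i v, π i (ι i v) = v) ∧ (∃ i x, S i x ∧ π i x ≠ 0) ∧ K.IsIndec := by
  let Q (K : LinRep s t) : Prop := ∃ (ι : Family K N) (π : Family N K), IsHom ι ∧ IsHom π ∧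
      (∀ i v, π i (ι i v) = v) ∧ (∃ i x, S i x ∧ π i x ≠ 0)
  obtain ⟨K, ⟨ι, π, hι, hπ, hπι, i, x, hx, hx0⟩, hmin⟩ :=
    exists_minimalFor_of_wellFoundedLT Q (fun K => ∑ i, K.dim i)
      ⟨N, _, _, isHom_id, isHom_id, fun _ _ => rfl, hS⟩
  refine ⟨K, ι, π, hι, hπ, hπι, ⟨i, x, hx, hx0⟩, ⟨i, ⟨π i x, 0, hx0⟩⟩, ?_⟩
  have key : ∀ p : Family K K, IsHom p → (∀ i v, p i (p i v) = p i v) → p i (π i x) ≠ 0 →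
      ∀ i v, p i v = v := by
    intro p hp hpp hpx
    have hU : ∀ a, ∀ v ∈ LinearMap.range (p (s a)), K.map a v ∈ LinearMap.range (p (t a)) := by
      rintro a _ ⟨w, rfl⟩
      exact ⟨_, (hp a w).symm⟩
    have hQ : Q (K.sub (fun i => LinearMap.range (p i)) hU) := by
      refine ⟨fun i => ι i ∘ₗ (LinearMap.range (p i)).subtype,
        fun i => (p i).rangeRestrict ∘ₗ π i, fun a v => ?_, fun a v => ?_, ?_,
        i, x, hx, fun h => hpx (congrArg Subtype.val h)⟩
      · exact hι a v.1
      · apply Subtype.ext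
        change K.map a (p (s a) (π (s a) v)) = p (t a) (π (t a) (N.map a v))
        rw [hp a, hπ a]
      · rintro i ⟨_, w, rfl⟩
        apply Subtype.ext
        change p i (π i (ι i (p i w))) = p i w
        rw [hπι, hpp]
    have hle : ∀ i ∈ Finset.univ, (K.sub (fun i => LinearMap.range (p i)) hU).dim i ≤ K.dim i :=
      fun i _ => Submodule.finrank_le (LinearMap.range (p i))
    have hsum := le_antisymm (Finset.sum_le_sum hle) (hmin hQ (Finset.sum_le_sum hle))
    intro i v
    have htop : LinearMap.range (p i) = ⊤ := Submodule.eq_top_of_finrank_eq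
      ((Finset.sum_eq_sum_iff_of_le hle).1 hsum i (Finset.mem_univ i))
    obtain ⟨w, rfl⟩ := LinearMap.range_eq_top.1 htop v
    exact hpp i w
  intro p hp hpp
  by_cases hpx : p i (π i x) = 0
  · left
    have h := key (fun i => LinearMap.id - p i) (isHom_id.sub hp)
      (fun i v => by simp [hpp]) (by simpa [hpx] using hx0)
    intro i v
    simpa using h i v
  · exact Or.inr (key p hp hpp hpx)

/-- An indecomposable representation with non-scalar endomorphisms has a nonzero endomorphism
of square zero. -/
theorem IsIndec.exists_sq_zero [Fintype V] (hX : IsIndec X)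
    (hb : ¬ ∀ f : Family X X, IsHom f → ∃ c : ℂ, ∀ i v, f i v = c • v) :
    ∃ f : Family X X, IsHom f ∧ (∀ i v, f i (f i v) = 0) ∧ ∃ i v, f i v ≠ 0 := by
  push Not at hb
  obtain ⟨f, hf, hfc⟩ := hb
  obtain ⟨i, hi⟩ := hX.1
  obtain ⟨c, hc⟩ := Module.End.exists_eigenvalue (f i : Module.End ℂ (X.space i))
  obtain ⟨v, hv⟩ := hc.exists_hasEigenvector
  let g : Family X X := fun i => f i - c • LinearMap.id
  have hg : IsHom g := hf.sub fun a v => by simp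
  have hgn := hX.nilpotent hg hv.2 (by simpa [g, sub_eq_zero] using hv.apply_eq_smul)
  classical
  obtain ⟨n, hn, hmin⟩ : ∃ n, (∀ i, (g i : Module.End ℂ (X.space i)) ^ n = 0) ∧
      ∀ m < n, ¬ ∀ i, (g i : Module.End ℂ (X.space i)) ^ m = 0 :=
    ⟨Nat.find hgn, Nat.find_spec hgn, fun m hm => Nat.find_min hgn hm⟩
  match n, hn, hmin with
  | 0, hn, _ =>
    obtain ⟨w, hw⟩ := exists_ne (0 : X.space i)
    exact absurd (LinearMap.congr_fun (hn i) w) hw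
  | 1, hn, _ =>
    obtain ⟨j, w, hw⟩ := hfc c
    have := LinearMap.congr_fun (hn j) w
    rw [pow_one] at this
    exact absurd (sub_eq_zero.1 this) hw
  | n + 2, hn, hmin =>
    refine ⟨_, hg.pow (n + 1), fun i v => ?_, ?_⟩
    · rw [← Module.End.mul_apply, ← pow_add, show n + 1 + (n + 1) = n + (n + 2) by ring, pow_add,
        hn i, mul_zero, LinearMap.zero_apply]
    · by_contra! h
      exact hmin (n + 1) (by omega) fun i => LinearMap.ext (h i)

/-- If `K` is rigid, `j : X → K` is a morphism and `π : X → K` is a family of linear maps that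
commutes with the structure maps on the kernel of `j`, then some morphism `X → K` agrees with `π`
on the kernel of `j`. -/
theorem ExtZero.exists_correction {K : LinRep s t} (hK : ExtZero K K) {j : Family X K}
    (hj : IsHom j) (π : Family X K)
    (h : ∀ a v, j (s a) v = 0 → K.map a (π (s a) v) = π (t a) (X.map a v)) :
    ∃ π' : Family X K, IsHom π' ∧ ∀ i v, j i v = 0 → π' i v = π i v := by
  choose c hc using fun a => LinearMap.exists_factor_of_ker (j (s a)) (coboundary X K π a)
    (fun v hv => sub_eq_zero.2 (h a v hv))
  obtain ⟨f, hf⟩ := hK c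
  refine ⟨fun i => π i - f i ∘ₗ j i, fun a v => ?_, fun i v hv => by simp [hv]⟩
  have h1 := hc a v
  rw [← hf, coboundary_apply, coboundary_apply, hj a] at h1
  simp only [LinearMap.sub_apply, LinearMap.comp_apply, map_sub]
  rw [sub_eq_sub_iff_sub_eq_sub, ← h1]

/-- Indecomposable representations of Dynkin quivers are rigid. -/
theorem IsIndec.extZero [Fintype V] [Fintype A] (hQ : IsDynkin s t) (hX : IsIndec X) :
    ExtZero X X := by
  induction hn : ∑ i, X.dim i using Nat.strong_induction_on generalizing X with
  | _ n ih =>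
  by_contra hext
  obtain ⟨θ, ⟨hθ, hθθ, i₀, v₀, hθ0⟩, hmax⟩ := exists_maximal_ker _
    (hX.exists_sq_zero fun hb => hext (extZero_of_brick hQ hX.1 hb))
  let N : LinRep s t := X.sub (fun i => LinearMap.ker (θ i)) fun a v hv => by
    rw [LinearMap.mem_ker] at hv ⊢
    rw [← hθ a, hv, map_zero]
  let θ' : Family X N := fun i => (θ i).codRestrict (LinearMap.ker (θ i)) (hθθ i)
  have hθ' : IsHom θ' := fun a v => Subtype.ext (hθ a v)
  let inc : Family N X := fun i => (LinearMap.ker (θ i)).subtype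
  have hinc : IsHom inc := fun a v => rfl
  obtain ⟨K, ι, π, hι, hπ, hπι, ⟨i₁, _, ⟨w, rfl⟩, hw⟩, hK⟩ := exists_indec_summand N
    (fun i x => ∃ w, θ' i w = x)
    ⟨i₀, θ' i₀ v₀, ⟨v₀, rfl⟩, fun h => hθ0 (congrArg Subtype.val h)⟩
  have hinj : ∀ i, Function.Injective (ι i) := fun i => Function.LeftInverse.injective (hπι i)
  have hdim : ∀ i, K.dim i ≤ N.dim i := fun i =>
    LinearMap.finrank_le_finrank_of_injective (hinj i)
  have hdim' : ∀ i, N.dim i ≤ X.dim i := fun i => Submodule.finrank_le (LinearMap.ker (θ i))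
  have hlt : N.dim i₀ < X.dim i₀ := Submodule.finrank_lt fun h =>
    hθ0 (LinearMap.congr_fun (LinearMap.ker_eq_top.1 h) v₀)
  have hKext : ExtZero K K := ih _ (hn ▸ Finset.sum_lt_sum
    (fun i _ => (hdim i).trans (hdim' i))
    ⟨i₀, Finset.mem_univ _, (hdim i₀).trans_lt hlt⟩) hK rfl
  let j : Family X K := fun i => π i ∘ₗ θ' i
  have hj : IsHom j := hπ.comp hθ'
  have hj0 : ∀ i v, θ i v = 0 → j i v = 0 := fun i v hv => by
    have : θ' i v = 0 := Subtype.ext hv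
    simp [j, this]
  have hj1 : ∀ i v, j i v = 0 → θ i v = 0 := fun i v hv => by
    refine hmax (fun i => inc i ∘ₗ ι i ∘ₗ j i) ⟨hinc.comp (hι.comp hj), fun i v => ?_,
      i₁, w, fun h => hw (hinj i₁ ?_)⟩ (fun i v hv => by simp [hj0 i v hv]) i v (by simp [hv])
    · change inc i (ι i (j i (inc i (ι i (j i v))))) = 0
      rw [hj0 i (inc i _) (ι i (j i v)).2, map_zero, map_zero]
    · rw [map_zero]
      exact Subtype.ext h
  choose π₁ hπ₁ using fun i => (π i).exists_extend
  obtain ⟨π₂, hπ₂, hπ₂'⟩ := hKext.exists_correction hj π₁ fun a v hv => by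
    have hv' := hj1 _ v hv
    have h1 : π₁ (s a) v = π (s a) ⟨v, hv'⟩ := LinearMap.congr_fun (hπ₁ (s a)) ⟨v, hv'⟩
    have h2 : π₁ (t a) (X.map a v) = π (t a) (N.map a ⟨v, hv'⟩) :=
      LinearMap.congr_fun (hπ₁ (t a)) (N.map a ⟨v, hv'⟩)
    rw [h1, h2, hπ a]
  have hπ₂π : ∀ i (x : N.space i), π₂ i x.1 = π i x := fun i x =>
    (hπ₂' i x.1 (hj0 i _ x.2)).trans (LinearMap.congr_fun (hπ₁ i) x)
  rcases hX.2 (fun i => inc i ∘ₗ ι i ∘ₗ π₂ i) (hinc.comp (hι.comp hπ₂))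
    (fun i v => congrArg (fun k => inc i (ι i k)) ((hπ₂π i _).trans (hπι i _))) with h | h
  · refine hw (hinj i₁ ?_)
    rw [map_zero, ← hπ₂π]
    exact Subtype.ext (h i₁ _)
  · refine hθ0 ?_
    rw [← h i₀ v₀]
    exact (ι i₀ (π₂ i₀ v₀)).2

theorem ExtZero.of_surjective (h : ExtZero X Y) {q : Family Y Z} (hq : IsHom q)
    (hs : ∀ i, Function.Surjective (q i)) : ExtZero X Z := fun c => by
  choose c' hc' using fun a => LinearMap.exists_lift_of_range (q (t a)) (c a)
    (fun v => hs (t a) (c a v))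
  obtain ⟨f, hf⟩ := h c'
  refine ⟨fun i => q i ∘ₗ f i, ?_⟩
  ext a v
  rw [← hc' a v, ← hf, coboundary_apply, coboundary_apply, map_sub, ← hq a]
  rfl

/-- If `X` is rigid, morphisms from `X` lift along epimorphisms whose kernel is a quotient
of `X`. -/
theorem ExtZero.exists_lift (h : ExtZero X X) {q : Family Y Z} (hq : IsHom q)
    (hs : ∀ i, Function.Surjective (q i)) {j : Family X Y} (hj : IsHom j)
    (hqj : ∀ i v, q i v = 0 ↔ ∃ w, j i w = v) {r : Family X Z} (hr : IsHom r) :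
    ∃ r' : Family X Y, IsHom r' ∧ ∀ i v, q i (r' i v) = r i v := by
  choose l hl using fun i => LinearMap.exists_lift_of_range (q i) (r i) (fun v => hs i (r i v))
  choose c hc using fun a => LinearMap.exists_lift_of_range (j (t a)) (coboundary X Y l a)
    (fun v => (hqj _ _).1 (by rw [coboundary_apply, map_sub, ← hq a, hl, hl, hr a, sub_self]))
  obtain ⟨k, hk⟩ := h c
  refine ⟨fun i => l i - j i ∘ₗ k i, fun a v => ?_, fun i v => ?_⟩
  · have h1 := hc a v
    rw [← hk, coboundary_apply, coboundary_apply, map_sub, ← hj a] at h1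
    simp only [LinearMap.sub_apply, LinearMap.comp_apply, map_sub]
    rw [sub_eq_sub_iff_sub_eq_sub, ← h1]
  · have h1 : q i (j i (k i v)) = 0 := (hqj _ _).2 ⟨_, rfl⟩
    simp [h1, hl]

variable {T E M : LinRep s t}

/-- In a non-split exact sequence `0 → T → E → M → 0` with the right almost split lifting
property, `Hom(M, T) = 0` as soon as `M` is rigid. -/
theorem homZero_of_almostSplit [Fintype V] (hM : ExtZero M M) (hT : IsIndec T)
    {f : Family T E} {g : Family E M} (hf : IsHom f) (hg : IsHom g)
    (hinj : ∀ i, Function.Injective (f i)) (hsurj : ∀ i, Function.Surjective (g i))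
    (hfg : ∀ i v, g i v = 0 ↔ ∃ w, f i w = v)
    (hsplit : ¬ ∃ σ : Family M E, IsHom σ ∧ ∀ i v, g i (σ i v) = v)
    (hlift : ∀ (X : LinRep s t) (h : Family X M), IsHom h →
      (¬ ∃ σ : Family M X, IsHom σ ∧ ∀ i v, h i (σ i v) = v) →
      ∃ u : Family X E, IsHom u ∧ ∀ i v, g i (u i v) = h i v) : HomZero M T := by
  intro φ hφ
  by_contra! hne
  obtain ⟨i₀, hne⟩ := hne
  obtain ⟨v₀, hv₀⟩ : ∃ v, φ i₀ v ≠ 0 := by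
    by_contra! h
    exact hne (LinearMap.ext h)
  let j : Family M E := fun i => f i ∘ₗ φ i
  have hj : IsHom j := hf.comp hφ
  have hgj : ∀ i v, g i (j i v) = 0 := fun i v => (hfg _ _).2 ⟨_, rfl⟩
  have hU : ∀ a, ∀ v ∈ LinearMap.range (j (s a)), E.map a v ∈ LinearMap.range (j (t a)) := by
    rintro a _ ⟨w, rfl⟩
    exact ⟨_, (hj a w).symm⟩
  let Q : LinRep s t := E.quot (fun i => LinearMap.range (j i)) hU
  let q : Family E Q := fun i => (LinearMap.range (j i)).mkQ
  have hq : IsHom q := fun a v => rfl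
  have hqs : ∀ i, Function.Surjective (q i) := fun i => Submodule.mkQ_surjective _
  have hqj : ∀ i v, q i v = 0 ↔ ∃ w, j i w = v := fun i v =>
    Submodule.Quotient.mk_eq_zero (LinearMap.range (j i))
  let g' : Family Q M := fun i => (LinearMap.range (j i)).liftQ (g i) (by
    rintro _ ⟨w, rfl⟩
    exact hgj i w)
  have hgq : ∀ i v, g' i (q i v) = g i v := fun i v => rfl
  have hg' : IsHom g' := fun a v => by
    obtain ⟨v, rfl⟩ := hqs _ v
    rw [hgq, hq a, hgq, hg a]
  obtain ⟨u, hu, hgu⟩ := hlift Q g' hg' fun ⟨r, hr, hr'⟩ => by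
    obtain ⟨r', hr₁, hr₂⟩ := hM.exists_lift hq hqs hj hqj hr
    exact hsplit ⟨r', hr₁, fun i v => by rw [← hgq, hr₂, hr']⟩
  let ψ : Family E E := fun i => u i ∘ₗ q i
  have hψ : IsHom ψ := hu.comp hq
  have hgψ : ∀ i v, g i (ψ i v) = g i v := fun i v => (hgu i _).trans (hgq i v)
  choose e he using fun i => LinearMap.exists_lift_of_range (f i) (ψ i ∘ₗ f i)
    (fun v => (hfg _ _).1 ((hgψ _ _).trans ((hfg _ _).2 ⟨v, rfl⟩)))
  have he' : ∀ i v, f i (e i v) = ψ i (f i v) := he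
  have hee : IsHom (X := T) (Y := T) e := fun a v => hinj _ (by
    rw [← hf a, he', he', hψ a, hf a])
  obtain ⟨n, hn⟩ := hT.nilpotent hee hv₀ (hinj i₀ (by
    have : q i₀ (f i₀ (φ i₀ v₀)) = 0 := (hqj _ _).2 ⟨v₀, rfl⟩
    rw [he', map_zero]
    change u i₀ (q i₀ (f i₀ (φ i₀ v₀))) = 0
    rw [this, map_zero]))
  have hψf : ∀ (n : ℕ) i v, ((ψ i : Module.End ℂ (E.space i)) ^ n) (f i v) =
      f i (((e i : Module.End ℂ (T.space i)) ^ n) v) := fun n i v => by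
    induction n generalizing v with
    | zero => rfl
    | succ n ih =>
      rw [pow_succ, Module.End.mul_apply, pow_succ, Module.End.mul_apply, ← ih]
      exact congrArg _ (he' i v).symm
  have hgψn : ∀ (n : ℕ) i v, g i (((ψ i : Module.End ℂ (E.space i)) ^ n) v) = g i v :=
    fun n i v => by
    induction n generalizing v with
    | zero => rfl
    | succ n ih => rw [pow_succ, Module.End.mul_apply, ih, hgψ]
  choose σ hσ using fun i => LinearMap.exists_factor_of_ker (g i)
    ((ψ i : Module.End ℂ (E.space i)) ^ n) (fun v hv => by
      obtain ⟨w, rfl⟩ := (hfg _ _).1 hv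
      rw [hψf, hn i, LinearMap.zero_apply, map_zero])
  refine hsplit ⟨σ, fun a v => ?_, fun i v => ?_⟩
  · obtain ⟨w, rfl⟩ := hsurj _ v
    rw [hσ, hg a, hσ, hψ.pow n a]
  · obtain ⟨w, rfl⟩ := hsurj _ v
    rw [hσ, hgψn]

/-- Let `M` be rigid with `Hom(M, T) = 0`. In an exact sequence `0 → T → E → M`, every
subrepresentation of `E` of dimension vector `dim M` is the image of a section of `E → M`. -/
theorem exists_section_of_finrank_eq [Fintype V] [Fintype A] (hM : ExtZero M M)
    (hMT : HomZero M T) {f : Family T E} {g : Family E M} (hf : IsHom f) (hg : IsHom g)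
    (hinj : ∀ i, Function.Injective (f i)) (hfg : ∀ i v, g i v = 0 ↔ ∃ w, f i w = v)
    (N : ∀ i, Submodule ℂ (E.space i)) (hN : ∀ a, ∀ v ∈ N (s a), E.map a v ∈ N (t a))
    (hdim : ∀ i, Module.finrank ℂ (N i) = M.dim i) :
    ∃ σ : Family M E, IsHom σ ∧ (∀ i v, g i (σ i v) = v) ∧
      ∀ i, N i = LinearMap.range (σ i) := by
  let K : LinRep s t := T.sub (fun i => (N i).comap (f i)) fun a v hv => by
    rw [Submodule.mem_comap] at hv ⊢
    rw [← hf a]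
    exact hN a _ hv
  let k : ∀ i, N i →ₗ[ℂ] M.space i := fun i => g i ∘ₗ (N i).subtype
  let Q : LinRep s t := M.quot (fun i => LinearMap.range (k i)) (by
    rintro a _ ⟨w, rfl⟩
    exact ⟨⟨E.map a w, hN a _ w.2⟩, (hg a w).symm⟩)
  have hKdim : ∀ i, Module.finrank ℂ (LinearMap.ker (k i)) = K.dim i := fun i => by
    let m : K.space i →ₗ[ℂ] N i :=
      (f i ∘ₗ ((N i).comap (f i)).subtype).codRestrict (N i) fun v => v.2
    have hm : Function.Injective m := fun v w h => Subtype.ext (hinj i (congrArg Subtype.val h))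
    have hmr : LinearMap.range m = LinearMap.ker (k i) := by
      ext v
      constructor
      · rintro ⟨w, rfl⟩
        exact (hfg _ _).2 ⟨w.1, rfl⟩
      · intro hv
        obtain ⟨w, hw⟩ := (hfg i v.1).1 hv
        exact ⟨⟨w, by rw [Submodule.mem_comap, hw]; exact v.2⟩, Subtype.ext hw⟩
    rw [← hmr]
    exact LinearMap.finrank_range_of_inj hm
  have hQK : ∀ i, Q.dim i = K.dim i := fun i => by
    have h1 := (k i).finrank_range_add_finrank_ker
    have h2 := (LinearMap.range (k i)).finrank_quotient_add_finrank
    rw [hKdim, hdim] at h1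
    change Q.dim i + _ = M.dim i at h2
    omega
  have hMK : HomZero M K := fun φ hφ i => by
    have h := hMT (fun i => ((N i).comap (f i)).subtype ∘ₗ φ i) (fun a v =>
      congrArg Subtype.val (hφ a v)) i
    ext v
    exact LinearMap.congr_fun h v
  let q : Family M Q := fun i => (LinearMap.range (k i)).mkQ
  have hq : IsHom q := fun a v => rfl
  have hq0 : q = 0 := by
    by_contra hne
    have h1 := eulerForm_pos_of_extZero
      (hM.of_surjective hq fun i => Submodule.mkQ_surjective _) hq hne
    have h2 := eulerForm_nonpos_of_homZero hMK
    simp only [hQK] at h1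
    omega
  have hks : ∀ i, Function.Surjective (k i) := fun i v =>
    (Submodule.Quotient.mk_eq_zero (LinearMap.range (k i))).1
      (LinearMap.congr_fun (congrFun hq0 i) v)
  have hki : ∀ i, Function.Injective (k i) := fun i =>
    (LinearMap.injective_iff_surjective_of_finrank_eq_finrank (hdim i)).2 (hks i)
  let ε : ∀ i, N i ≃ₗ[ℂ] M.space i := fun i => LinearEquiv.ofBijective (k i) ⟨hki i, hks i⟩
  have hkε : ∀ i v, g i ((ε i).symm v) = v := fun i v => (ε i).apply_symm_apply v
  refine ⟨fun i => (N i).subtype ∘ₗ (ε i).symm.toLinearMap, fun a v => ?_, hkε, fun i => ?_⟩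
  · have h : (⟨E.map a ((ε (s a)).symm v), hN a _ ((ε (s a)).symm v).2⟩ : N (t a)) =
        (ε (t a)).symm (M.map a v) := hki _ (by
      change g (t a) (E.map a ((ε (s a)).symm v)) = g (t a) ((ε (t a)).symm (M.map a v))
      rw [← hg a, hkε, hkε])
    exact congrArg Subtype.val h
  · rw [LinearMap.range_comp_of_range_eq_top _ (LinearEquiv.range _), Submodule.range_subtype]

/-- The representation on the spaces `ℂ^{d i}` given by matrices. -/
abbrev ofMatrix (s t : A → V) {d : V → ℕ} (M : QRep s t d) : LinRep s t where
  space i := Fin (d i) → ℂ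
  map a := (M a).mulVecLin

section Matrix

variable {d e : V → ℕ} {P : QRep s t d} {R : QRep s t e}

/-- The morphism of linear representations defined by a matrix morphism. -/
abbrev ofRHom (φ : RHom s t P R) : Family (ofMatrix s t P) (ofMatrix s t R) :=
  fun i => (φ.1 i).mulVecLin

theorem isHom_ofRHom (φ : RHom s t P R) : IsHom (ofRHom φ) := fun a v => by
  simp [ofRHom, φ.2 a]

/-- The matrix morphism defined by a morphism of linear representations. -/
def toRHom (f : Family (ofMatrix s t P) (ofMatrix s t R)) (hf : IsHom f) : RHom s t P R :=
  ⟨fun i => LinearMap.toMatrix' (f i), fun a => by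
    apply Matrix.toLin'.injective
    refine LinearMap.ext fun v => ?_
    simpa [Matrix.toLin'_mul] using hf a v⟩

theorem toRHom_mulVec (f : Family (ofMatrix s t P) (ofMatrix s t R)) (hf : IsHom f) (i : V)
    (v : Fin (d i) → ℂ) : (toRHom f hf).1 i *ᵥ v = f i v :=
  LinearMap.toMatrix'_mulVec (f i) v

theorem isIndec_ofMatrix (h : Indec s t P) : IsIndec (ofMatrix s t P) := by
  obtain ⟨⟨i, hi⟩, h⟩ := h
  refine ⟨⟨i, ?_⟩, fun p hp hpp => ?_⟩
  · have : Nonempty (Fin (d i)) := ⟨⟨0, hi⟩⟩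
    infer_instance
  · refine (h (toRHom p hp) fun j => Matrix.ext_of_mulVec_single fun k => ?_).imp
      (fun h j v => ?_) (fun h j v => ?_)
    · rw [← Matrix.mulVec_mulVec, toRHom_mulVec, toRHom_mulVec, hpp]
    · rw [← toRHom_mulVec p hp, h, Matrix.zero_mulVec]
    · rw [← toRHom_mulVec p hp, h, Matrix.one_mulVec]

theorem isSplitEpi_of_section (φ : RHom s t P R) {σ : Family (ofMatrix s t R) (ofMatrix s t P)}
    (hσ : IsHom σ) (h : ∀ i v, ofRHom φ i (σ i v) = v) : IsSplitEpi s t φ :=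
  ⟨toRHom σ hσ, fun i => Matrix.ext_of_mulVec_single fun k => by
    rw [← Matrix.mulVec_mulVec, toRHom_mulVec, Matrix.one_mulVec]
    exact h i _⟩

/-- The lifting property of a matrix morphism against matrix representations extends to all
finite-dimensional representations. -/
theorem exists_lift_of_matrix {φ : RHom s t P R}
    (hlift : ∀ (x : V → ℕ) (X : QRep s t x) (h : RHom s t X R), ¬ IsSplitEpi s t h →
      ∃ u : RHom s t X P, ∀ i, φ.1 i * u.1 i = h.1 i)
    (X : LinRep s t) (h : Family X (ofMatrix s t R)) (hh : IsHom h)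
    (hs : ¬ ∃ σ : Family (ofMatrix s t R) X, IsHom σ ∧ ∀ i v, h i (σ i v) = v) :
    ∃ u : Family X (ofMatrix s t P), IsHom u ∧ ∀ i v, ofRHom φ i (u i v) = h i v := by
  let ε : ∀ i, X.space i ≃ₗ[ℂ] (Fin (X.dim i) → ℂ) := fun i =>
    (Module.finBasis ℂ (X.space i)).equivFun
  let X' : QRep s t X.dim := fun a =>
    LinearMap.toMatrix' ((ε (t a)).toLinearMap ∘ₗ X.map a ∘ₗ (ε (s a)).symm.toLinearMap)
  have hX' : ∀ a v, X' a *ᵥ v = ε (t a) (X.map a ((ε (s a)).symm v)) := fun a v =>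
    LinearMap.toMatrix'_mulVec _ v
  have hε : IsHom (X := X) (Y := ofMatrix s t X') fun i => (ε i).toLinearMap := fun a v => by
    simp [hX']
  have hε' : IsHom (X := ofMatrix s t X') (Y := X) fun i => (ε i).symm.toLinearMap :=
    fun a v => by simp [hX']
  let h' := toRHom _ (hh.comp hε')
  have hh' : ∀ i v, h'.1 i *ᵥ v = h i ((ε i).symm v) := fun i v => toRHom_mulVec _ _ i v
  obtain ⟨u, hu⟩ := hlift _ X' h' fun ⟨r, hr⟩ =>
    hs ⟨_, hε'.comp (isHom_ofRHom r), fun i v => by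
      change h i ((ε i).symm (r.1 i *ᵥ v)) = v
      rw [← hh', Matrix.mulVec_mulVec, hr, Matrix.one_mulVec]⟩
  refine ⟨_, (isHom_ofRHom u).comp hε, fun i v => ?_⟩
  change φ.1 i *ᵥ (u.1 i *ᵥ ε i v) = h i v
  rw [Matrix.mulVec_mulVec, hu, hh', LinearEquiv.symm_apply_apply]

theorem dsum_mulVec_castAdd (a : A) (v : Fin (d (s a) + e (s a)) → ℂ) (k : Fin (d (t a))) :
    (dsum s t P R a *ᵥ v) (Fin.castAdd _ k) = (P a *ᵥ fun l => v (Fin.castAdd _ l)) k := by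
  simp [dsum, Matrix.mulVec, dotProduct, Fin.sum_univ_add]

theorem dsum_mulVec_natAdd (a : A) (v : Fin (d (s a) + e (s a)) → ℂ) (k : Fin (e (t a))) :
    (dsum s t P R a *ᵥ v) (Fin.natAdd _ k) = (R a *ᵥ fun l => v (Fin.natAdd _ l)) k := by
  simp [dsum, Matrix.mulVec, dotProduct, Fin.sum_univ_add]

theorem inclMat_mulVec_castAdd (m n : ℕ) (v : Fin m → ℂ) (k : Fin m) :
    (inclMat m n *ᵥ v) (Fin.castAdd n k) = v k := by
  simp [inclMat, Matrix.mulVec, dotProduct, Matrix.one_apply]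

theorem inclMat_mulVec_natAdd (m n : ℕ) (v : Fin m → ℂ) (k : Fin n) :
    (inclMat m n *ᵥ v) (Fin.natAdd m k) = 0 := by
  have h0 : ∀ l, inclMat m n (Fin.natAdd m k) l = 0 := fun l => Matrix.one_apply_ne fun h => ?_
  · simp [Matrix.mulVec, dotProduct, h0]
  have := congrArg Fin.val h
  simp only [id_eq, Fin.val_natAdd, Fin.val_castAdd] at this
  omega

variable (P R) in
/-- The canonical inclusion of the first summand. -/
abbrev inl : Family (ofMatrix s t P) (ofMatrix s t (dsum s t P R)) :=
  fun i => (inclMat (d i) (e i)).mulVecLin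

variable (P R) in
/-- The canonical projection onto the first summand. -/
abbrev fst : Family (ofMatrix s t (dsum s t P R)) (ofMatrix s t P) :=
  fun i => LinearMap.funLeft ℂ ℂ (Fin.castAdd (e i))

variable (P R) in
/-- The canonical projection onto the second summand. -/
abbrev snd : Family (ofMatrix s t (dsum s t P R)) (ofMatrix s t R) :=
  fun i => LinearMap.funLeft ℂ ℂ (Fin.natAdd (d i))

variable (P R) in
/-- The canonical inclusion of the second summand. -/
abbrev inr : Family (ofMatrix s t R) (ofMatrix s t (dsum s t P R)) := fun i =>
  { toFun := fun v => Fin.append 0 v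
    map_add' := fun v w => funext fun k => by
      refine Fin.addCases (fun k => ?_) (fun k => ?_) k <;> simp
    map_smul' := fun c v => funext fun k => by
      refine Fin.addCases (fun k => ?_) (fun k => ?_) k <;> simp }

theorem isHom_fst : IsHom (fst P R) := fun a v =>
  funext fun k => (dsum_mulVec_castAdd a v k).symm

theorem isHom_snd : IsHom (snd P R) := fun a v =>
  funext fun k => (dsum_mulVec_natAdd a v k).symm

theorem fst_inl (i : V) (v : Fin (d i) → ℂ) : fst P R i (inl P R i v) = v :=
  funext fun k => inclMat_mulVec_castAdd _ _ v k

theorem snd_inl (i : V) (v : Fin (d i) → ℂ) : snd P R i (inl P R i v) = 0 :=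
  funext fun k => inclMat_mulVec_natAdd _ _ v k

theorem fst_inr (i : V) (v : Fin (e i) → ℂ) : fst P R i (inr P R i v) = 0 :=
  funext fun k => Fin.append_left _ _ k

theorem snd_inr (i : V) (v : Fin (e i) → ℂ) : snd P R i (inr P R i v) = v :=
  funext fun k => Fin.append_right _ _ k

theorem finrank_range_inclMat (m n : ℕ) :
    Module.finrank ℂ (LinearMap.range (inclMat m n).mulVecLin) = m := by
  rw [LinearMap.finrank_range_of_inj, Module.finrank_fin_fun]
  intro v w h
  ext k
  rw [← inclMat_mulVec_castAdd m n v, ← inclMat_mulVec_castAdd m n w]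
  exact congrFun h _

theorem inr_injective (i : V) : Function.Injective (inr P R i) :=
  Function.LeftInverse.injective (g := snd P R i) (snd_inr i)

theorem dsum_ext {i : V} {v w : Fin (d i + e i) → ℂ} (h₁ : fst P R i v = fst P R i w)
    (h₂ : snd P R i v = snd P R i w) : v = w :=
  funext fun k => Fin.addCases (fun k => congrFun h₁ k) (fun k => congrFun h₂ k) k

theorem isHom_inl : IsHom (inl P R) := fun a v => dsum_ext (P := P) (R := R)
  (by rw [← isHom_fst a, fst_inl, fst_inl]) (by rw [← isHom_snd a, snd_inl, snd_inl, map_zero])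

theorem isHom_inr : IsHom (inr P R) := fun a v => dsum_ext (P := P) (R := R)
  (by rw [← isHom_fst a, fst_inr, fst_inr, map_zero]) (by rw [← isHom_snd a, snd_inr, snd_inr])

theorem fst_eq_zero_iff (i : V) (v : Fin (d i + e i) → ℂ) :
    fst P R i v = 0 ↔ ∃ w, inr P R i w = v := by
  refine ⟨fun h => ⟨snd P R i v, dsum_ext (P := P) (R := R) ?_ ?_⟩, ?_⟩
  · rw [fst_inr, h]
  · rw [snd_inr]
  · rintro ⟨w, rfl⟩
    exact fst_inr i w

theorem snd_eq_zero_iff (i : V) (v : Fin (d i + e i) → ℂ) :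
    snd P R i v = 0 ↔ ∃ w, inl P R i w = v := by
  refine ⟨fun h => ⟨fst P R i v, dsum_ext (P := P) (R := R) ?_ ?_⟩, ?_⟩
  · rw [fst_inl]
  · rw [snd_inl, h]
  · rintro ⟨w, rfl⟩
    exact snd_inl i w

end Matrix

end LinRep

/-- For an almost split sequence `0 → τM → E → M → 0`:
`Gr_{dim M}(E) = ∅`, and `Gr_{dim M}(M ⊕ τM)` is a single reduced point, namely the
canonical embedding of `M`. -/
theorem almostSplit_grassmannian [Fintype V] [Fintype A] (s t : A → V)
    (hQ : IsDynkin s t) (dT dE dM : V → ℕ)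
    (T : QRep s t dT) (E : QRep s t dE) (M : QRep s t dM)
    (f : RHom s t T E) (g : RHom s t E M) (has : IsAlmostSplit s t f g) :
    IsEmpty (SubRep s t E dM) ∧
    (∃ x : SubRep s t (dsum s t M T) dM,
        ∀ i, x.1 i = LinearMap.range (inclMat (dM i) (dT i)).mulVecLin) ∧
    Subsingleton (SubRep s t (dsum s t M T) dM) ∧
    ∀ x : SubRep s t (dsum s t M T) dM,
      Module.finrank ℂ (TangentSp s t (dsum s t M T) x) = 0 := by
  obtain ⟨⟨hinj, hsurj, hexact⟩, hns, hT, hM, hlift⟩ := has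
  have hMr := (LinRep.isIndec_ofMatrix hM).extZero hQ
  have hfg : ∀ i v, LinRep.ofRHom g i v = 0 ↔ ∃ w, LinRep.ofRHom f i w = v := fun i v => by
    rw [← LinearMap.mem_range, hexact i, LinearMap.mem_ker]
  have hsplit : ¬ ∃ σ : LinRep.Family (LinRep.ofMatrix s t M) (LinRep.ofMatrix s t E),
      LinRep.IsHom σ ∧ ∀ i v, LinRep.ofRHom g i (σ i v) = v :=
    fun ⟨σ, hσ, h⟩ => hns (LinRep.isSplitEpi_of_section g hσ h)
  have hMT := LinRep.homZero_of_almostSplit hMr (LinRep.isIndec_ofMatrix hT)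
    (LinRep.isHom_ofRHom f) (LinRep.isHom_ofRHom g) hinj hsurj hfg hsplit
    (LinRep.exists_lift_of_matrix hlift)
  have hdimM : ∀ i, (LinRep.ofMatrix s t M).dim i = dM i := fun i => Module.finrank_fin_fun ℂ
  have hstable : ∀ {d : V → ℕ} {P : QRep s t d} (x : SubRep s t P dM) (a : A),
      ∀ v ∈ x.1 (s a), (LinRep.ofMatrix s t P).map a v ∈ x.1 (t a) :=
    fun x a v hv => x.2.2 a (Submodule.mem_map_of_mem hv)
  have hunique : ∀ (x : SubRep s t (dsum s t M T) dM) i,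
      x.1 i = LinearMap.range (inclMat (dM i) (dT i)).mulVecLin := fun x i => by
    obtain ⟨σ, hσ, hσ₁, hσ₂⟩ := LinRep.exists_section_of_finrank_eq hMr hMT LinRep.isHom_inr
      LinRep.isHom_fst LinRep.inr_injective
      LinRep.fst_eq_zero_iff x.1 (hstable x) fun i => (x.2.1 i).trans (hdimM i).symm
    have hσ₃ := hMT _ (LinRep.isHom_snd.comp hσ) i
    have hσ₄ : σ i = LinRep.inl M T i := LinearMap.ext fun v =>
      LinRep.dsum_ext (P := M) (R := T) ((hσ₁ i v).trans (LinRep.fst_inl i v).symm)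
        ((LinearMap.congr_fun hσ₃ v).trans (LinRep.snd_inl i v).symm)
    rw [hσ₂ i, hσ₄]
  refine ⟨⟨fun x => ?_⟩, ⟨⟨fun i => LinearMap.range (LinRep.inl M T i), fun i => ?_, ?_⟩,
    fun i => rfl⟩, ⟨fun x y => Subtype.ext (funext fun i => ?_)⟩, fun x => ?_⟩
  · obtain ⟨σ, hσ, h, -⟩ := LinRep.exists_section_of_finrank_eq hMr hMT (LinRep.isHom_ofRHom f)
      (LinRep.isHom_ofRHom g) hinj hfg x.1 (hstable x)
      fun i => (x.2.1 i).trans (hdimM i).symm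
    exact hsplit ⟨σ, hσ, h⟩
  · exact LinRep.finrank_range_inclMat (dM i) (dT i)
  · rintro a _ ⟨_, ⟨w, rfl⟩, rfl⟩
    exact ⟨_, (LinRep.isHom_inl a w).symm⟩
  · rw [hunique x, hunique y]
  · suffices h : TangentSp s t (dsum s t M T) x ≤ ⊥ by
      rw [le_bot_iff.1 h]
      exact finrank_bot ℂ _
    intro φ hφ
    have hx : ∀ i v, v ∈ x.1 i ↔ LinRep.snd M T i v = 0 := fun i v => by
      rw [hunique x, LinRep.snd_eq_zero_iff]
      rfl
    have hmem : ∀ i w, LinRep.inl M T i w ∈ x.1 i := fun i w =>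
      (hx _ _).2 (LinRep.snd_inl i w)
    let p : ∀ i, ((Fin (dM i + dT i) → ℂ) ⧸ x.1 i) →ₗ[ℂ] (Fin (dT i) → ℂ) := fun i =>
      (x.1 i).liftQ (LinRep.snd M T i) fun v hv => (hx i v).1 hv
    have hp : ∀ i y, p i y = 0 → y = 0 := fun i y hy => by
      obtain ⟨y, rfl⟩ := (x.1 i).mkQ_surjective y
      exact (Submodule.Quotient.mk_eq_zero _).2 ((hx i y).2 hy)
    let θ : LinRep.Family (LinRep.ofMatrix s t M) (LinRep.ofMatrix s t T) := fun i =>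
      p i ∘ₗ φ i ∘ₗ (LinRep.inl M T i).codRestrict (x.1 i) (hmem i)
    have hθ : LinRep.IsHom θ := fun a w => by
      have h1 := hφ a ⟨_, hmem _ w⟩
      have h2 : (⟨_, hmem _ ((LinRep.ofMatrix s t M).map a w)⟩ : x.1 (t a)) =
          ⟨(dsum s t M T a).mulVecLin (LinRep.inl M T (s a) w), hstable x a _ (hmem _ w)⟩ :=
        Subtype.ext (LinRep.isHom_inl a w).symm
      change (T a).mulVecLin (p (s a) (φ (s a) ⟨_, hmem _ w⟩)) =
        p (t a) (φ (t a) ⟨_, hmem _ ((LinRep.ofMatrix s t M).map a w)⟩)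
      rw [h2, h1]
      obtain ⟨y, hy⟩ := (x.1 (s a)).mkQ_surjective (φ (s a) ⟨_, hmem _ w⟩)
      rw [← hy]
      exact LinRep.isHom_snd a y
    rw [Submodule.mem_bot]
    funext i
    ext1 v
    obtain ⟨w, hw⟩ := (LinRep.snd_eq_zero_iff i v.1).1 ((hx i v.1).1 v.2)
    have hv : v = ⟨_, hmem i w⟩ := Subtype.ext hw.symm
    rw [hv]
    exact hp i _ (LinearMap.congr_fun (hMT θ hθ i) w)

end
end
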